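/- Let f ∈ Lip(α,p) with p > 1 and 0 < α < 1, let (p_k) be positive, P_n = p_0 + ... + p_n, and suppose (p_k) ∈ AMDMS, i.e., the Cesàro means of (p_k) form an almost monotone decreasing sequence, and (n+1) = O(P_n). Then ‖R_n(f) − f‖_{L^p} = O(n^{−α}). -/

import Mathlib

open MeasureTheory Finset Real

/-- The Dirichlet kernel `D_n(u) = 1/2 + ∑_{k=1}^n cos(k u)`. -/
noncomputable def dirichletKernel (n : ℕ) (u : ℝ) : ℝ :=
  1 / 2 + ∑ k ∈ Finset.Icc 1 n, Real.cos (k * u)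

/-- The `n`-th partial sum of the Fourier series of a `2π`-periodic function `f`,
`S_n(f;x) = (1/π) ∫_0^{2π} f(t) D_n(x - t) dt`. -/
noncomputable def partialFourierSum (f : ℝ → ℝ) (n : ℕ) (x : ℝ) : ℝ :=
  (1 / Real.pi) * ∫ t in (0 : ℝ)..(2 * Real.pi), f t * dirichletKernel n (x - t)

/-- The normalized `L^p` norm `‖f‖_{L^p} = ((1/2π) ∫_0^{2π} |f(x)|^p dx)^{1/p}`. -/
noncomputable def lpNorm (p : ℝ) (f : ℝ → ℝ) : ℝ :=
  ((1 / (2 * Real.pi)) * ∫ x in (0 : ℝ)..(2 * Real.pi), |f x| ^ p) ^ (1 / p)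

/-- The integral modulus of continuity
`ω_p(f;δ) = sup_{0<|h|≤δ} ((1/2π) ∫_0^{2π} |f(x+h) - f(x)|^p dx)^{1/p}`. -/
noncomputable def intModulus (p : ℝ) (f : ℝ → ℝ) (δ : ℝ) : ℝ :=
  sSup {y : ℝ | ∃ h : ℝ, 0 < |h| ∧ |h| ≤ δ ∧
    y = ((1 / (2 * Real.pi)) * ∫ x in (0 : ℝ)..(2 * Real.pi), |f (x + h) - f x| ^ p) ^ (1 / p)}

/-- `f ∈ Lip(α,p)`: `f` is `2π`-periodic, belongs to `L^p[0,2π]`, and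
`ω_p(f;δ) = O(δ^α)`. -/
def LipClass (α p : ℝ) (f : ℝ → ℝ) : Prop :=
  Function.Periodic f (2 * Real.pi) ∧
  IntervalIntegrable f MeasureTheory.volume 0 (2 * Real.pi) ∧
  IntervalIntegrable (fun x => |f x| ^ p) MeasureTheory.volume 0 (2 * Real.pi) ∧
  ∃ C : ℝ, 0 < C ∧ ∀ δ : ℝ, 0 < δ → intModulus p f δ ≤ C * δ ^ α

/-- The matrix transform `T_n(f;x) = ∑_{k=0}^n a_{n,k} S_k(f;x)`. -/
noncomputable def matrixMeans (a : ℕ → ℕ → ℝ) (f : ℝ → ℝ) (n : ℕ) (x : ℝ) : ℝ :=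
  ∑ k ∈ Finset.range (n + 1), a n k * partialFourierSum f k x

/-- `A_{n,m} = (1/(m+1)) ∑_{k=0}^m a_{n,k}`, the Cesàro mean of the `n`-th row. -/
noncomputable def rowMean (a : ℕ → ℕ → ℝ) (n m : ℕ) : ℝ :=
  (1 / ((m : ℝ) + 1)) * ∑ k ∈ Finset.range (m + 1), a n k

/-- The Riesz means `R_n(f;x) = (1/P_n) ∑_{k=0}^n p_k S_k(f;x)` with weights `w`. -/
noncomputable def rieszMeans (w : ℕ → ℝ) (f : ℝ → ℝ) (n : ℕ) (x : ℝ) : ℝ :=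
  (1 / (∑ k ∈ Finset.range (n + 1), w k)) *
    ∑ k ∈ Finset.range (n + 1), w k * partialFourierSum f k x

/-- The kernel `K_n(u) = ∑_{k=0}^n a_{n,k} sin((k+1/2)u)/(2 sin(u/2))`. -/
noncomputable def matrixKernel (a : ℕ → ℕ → ℝ) (n : ℕ) (u : ℝ) : ℝ :=
  ∑ k ∈ Finset.range (n + 1),
    a n k * (Real.sin (((k : ℝ) + 1 / 2) * u) / (2 * Real.sin (u / 2)))

theorem hasDerivAt_integral_of_continuous {h h' : ℝ → ℝ → ℝ}
    (hd : ∀ t θ, HasDerivAt (fun t => h t θ) (h' t θ) t)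
    (hc : Continuous (Function.uncurry h)) (hc' : Continuous (Function.uncurry h'))
    (a b t : ℝ) :
    HasDerivAt (fun t => ∫ θ in a..b, h t θ) (∫ θ in a..b, h' t θ) t := by
  have hsec : ∀ g : ℝ → ℝ → ℝ, Continuous (Function.uncurry g) → ∀ t, Continuous (g t) :=
    fun g hg t => hg.comp (by fun_prop : Continuous fun θ : ℝ => (t, θ))
  obtain ⟨C, hC⟩ := ((isCompact_closedBall t 1).prod
    (isCompact_uIcc (a := a) (b := b))).exists_bound_of_continuousOn hc'.continuousOn
  refine (intervalIntegral.hasDerivAt_integral_of_dominated_loc_of_deriv_le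
    (bound := fun _ => C) (F' := h') (Metric.closedBall_mem_nhds t one_pos)
    (.of_forall fun s => (hsec h hc s).aestronglyMeasurable)
    ((hsec h hc t).intervalIntegrable _ _) (hsec h' hc' t).aestronglyMeasurable
    (.of_forall fun θ hθ s hs => ?_) intervalIntegrable_const
    (.of_forall fun θ _ s _ => hd s θ)).2
  exact hC (s, θ) ⟨hs, Set.uIoc_subset_uIcc hθ⟩

/-- The mean over a period of a function of `(t, θ)` with nonnegative Laplacian is convex. -/
theorem convexOn_integral_of_laplacian_nonneg {h h₁ h₂ k₁ k₂ : ℝ → ℝ → ℝ} {a b : ℝ} (hab : a ≤ b)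
    (hd₁ : ∀ t θ, HasDerivAt (fun t => h t θ) (h₁ t θ) t)
    (hd₂ : ∀ t θ, HasDerivAt (fun t => h₁ t θ) (h₂ t θ) t)
    (kd₂ : ∀ t θ, HasDerivAt (fun θ => k₁ t θ) (k₂ t θ) θ)
    (hc : Continuous (Function.uncurry h)) (hc₁ : Continuous (Function.uncurry h₁))
    (hc₂ : Continuous (Function.uncurry h₂)) (kc₂ : Continuous (Function.uncurry k₂))
    (hper : ∀ t, k₁ t a = k₁ t b) (hlap : ∀ t θ, 0 ≤ h₂ t θ + k₂ t θ) :
    ConvexOn ℝ Set.univ (fun t => ∫ θ in a..b, h t θ) := by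
  have hsec : ∀ g : ℝ → ℝ → ℝ, Continuous (Function.uncurry g) → ∀ t, Continuous (g t) :=
    fun g hg t => hg.comp (by fun_prop : Continuous fun θ : ℝ => (t, θ))
  refine convexOn_of_hasDerivWithinAt2_nonneg convex_univ
    (fun t _ => (hasDerivAt_integral_of_continuous hd₁ hc hc₁ a b t).continuousAt.continuousWithinAt)
    (fun t _ => (hasDerivAt_integral_of_continuous hd₁ hc hc₁ a b t).hasDerivWithinAt)
    (fun t _ => (hasDerivAt_integral_of_continuous hd₂ hc₁ hc₂ a b t).hasDerivWithinAt)
    (fun t _ => ?_)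
  have hk : ∫ θ in a..b, k₂ t θ = 0 := by
    rw [intervalIntegral.integral_eq_sub_of_hasDerivAt (fun θ _ => kd₂ t θ)
      ((hsec k₂ kc₂ t).intervalIntegrable _ _), hper, sub_self]
  have hadd := intervalIntegral.integral_add (μ := volume)
    ((hsec h₂ hc₂ t).intervalIntegrable a b) ((hsec k₂ kc₂ t).intervalIntegrable a b)
  rw [hk, add_zero] at hadd
  rw [← hadd]
  exact intervalIntegral.integral_nonneg hab fun θ _ => hlap t θ

/-- The analytic polynomial `∑ c_k z^k` at `z = exp (t + iθ)`. -/
noncomputable def expPoly (c : ℕ → ℂ) (M : ℕ) (t θ : ℝ) : ℂ :=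
  ∑ k ∈ range M, c k * Complex.exp (k * (t + θ * Complex.I))

theorem continuous_expPoly (c : ℕ → ℂ) (M : ℕ) : Continuous (Function.uncurry (expPoly c M)) := by
  unfold expPoly Function.uncurry
  fun_prop

theorem hasDerivAt_expPoly_fst (c : ℕ → ℂ) (M : ℕ) (t θ : ℝ) :
    HasDerivAt (fun t => expPoly c M t θ) (expPoly (fun k => k * c k) M t θ) t := by
  unfold expPoly
  refine HasDerivAt.fun_sum fun k _ => ?_
  have h1 : HasDerivAt (fun t : ℝ => (k : ℂ) * ((t : ℂ) + θ * Complex.I)) (k * 1) t :=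
    ((Complex.ofRealCLM.hasDerivAt (x := t)).add_const _).const_mul _
  exact (h1.cexp.const_mul (c k)).congr_deriv (by ring)

theorem hasDerivAt_expPoly_snd (c : ℕ → ℂ) (M : ℕ) (t θ : ℝ) :
    HasDerivAt (fun θ => expPoly c M t θ) (Complex.I * expPoly (fun k => k * c k) M t θ) θ := by
  unfold expPoly
  rw [mul_sum]
  refine HasDerivAt.fun_sum fun k _ => ?_
  have h1 : HasDerivAt (fun θ : ℝ => (k : ℂ) * ((t : ℂ) + θ * Complex.I)) (k * (1 * Complex.I)) θ :=
    (((Complex.ofRealCLM.hasDerivAt (x := θ)).mul_const Complex.I).const_add (t : ℂ)).const_mul _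
  exact (h1.cexp.const_mul (c k)).congr_deriv (by ring)

theorem expPoly_two_pi (c : ℕ → ℂ) (M : ℕ) (t : ℝ) :
    expPoly c M t (2 * π) = expPoly c M t 0 := by
  unfold expPoly
  refine sum_congr rfl fun k _ => ?_
  have : (k : ℂ) * (t + (2 * π : ℝ) * Complex.I) =
      k * (t + (0 : ℝ) * Complex.I) + k * (2 * π * Complex.I) := by push_cast; ring
  rw [this, Complex.exp_add, Complex.exp_nat_mul_two_pi_mul_I, mul_one]

/-- Mean value inequality for `Φ(Re F, Im F)` with `Φ` subharmonic and `F` an analytic polynomial. -/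
theorem mean_value_subharmonic_expPoly {Φ Φx Φy Φxx Φxy Φyy : ℝ → ℝ → ℝ}
    (hΦ : ∀ (u v : ℝ → ℝ) (u' v' s : ℝ), HasDerivAt u u' s → HasDerivAt v v' s →
      HasDerivAt (fun s => Φ (u s) (v s)) (Φx (u s) (v s) * u' + Φy (u s) (v s) * v') s)
    (hΦx : ∀ (u v : ℝ → ℝ) (u' v' s : ℝ), HasDerivAt u u' s → HasDerivAt v v' s →
      HasDerivAt (fun s => Φx (u s) (v s)) (Φxx (u s) (v s) * u' + Φxy (u s) (v s) * v') s)
    (hΦy : ∀ (u v : ℝ → ℝ) (u' v' s : ℝ), HasDerivAt u u' s → HasDerivAt v v' s →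
      HasDerivAt (fun s => Φy (u s) (v s)) (Φxy (u s) (v s) * u' + Φyy (u s) (v s) * v') s)
    (hc : Continuous (Function.uncurry Φ)) (hcx : Continuous (Function.uncurry Φx))
    (hcy : Continuous (Function.uncurry Φy)) (hcxx : Continuous (Function.uncurry Φxx))
    (hcxy : Continuous (Function.uncurry Φxy)) (hcyy : Continuous (Function.uncurry Φyy))
    (hlap : ∀ x y, 0 ≤ Φxx x y + Φyy x y) (c : ℕ → ℂ) (M : ℕ) :
    2 * π * Φ (c 0).re (c 0).im ≤
      ∫ θ in (0 : ℝ)..2 * π, Φ (expPoly c (M + 1) 0 θ).re (expPoly c (M + 1) 0 θ).im := by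
  set W := expPoly c (M + 1) with hW
  set W₁ := expPoly (fun k => k * c k) (M + 1) with hW₁
  set W₂ := expPoly (fun k => k * (k * c k)) (M + 1) with hW₂
  have re_d : ∀ (w : ℝ → ℂ) (w' : ℂ) (s : ℝ), HasDerivAt w w' s →
      HasDerivAt (fun s => (w s).re) w'.re s := fun w w' s h =>
    (Complex.reCLM.hasFDerivAt.comp_hasDerivAt s h)
  have im_d : ∀ (w : ℝ → ℂ) (w' : ℂ) (s : ℝ), HasDerivAt w w' s →
      HasDerivAt (fun s => (w s).im) w'.im s := fun w w' s h =>
    (Complex.imCLM.hasFDerivAt.comp_hasDerivAt s h)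
  have hWt : ∀ t θ, HasDerivAt (fun t => W t θ) (W₁ t θ) t := hasDerivAt_expPoly_fst _ _
  have hW₁t : ∀ t θ, HasDerivAt (fun t => W₁ t θ) (W₂ t θ) t := hasDerivAt_expPoly_fst _ _
  have hWθ : ∀ t θ, HasDerivAt (fun θ => W t θ) (Complex.I * W₁ t θ) θ :=
    hasDerivAt_expPoly_snd _ _
  have hW₁θ : ∀ t θ, HasDerivAt (fun θ => W₁ t θ) (Complex.I * W₂ t θ) θ :=
    hasDerivAt_expPoly_snd _ _
  have cW : Continuous (Function.uncurry W) := continuous_expPoly _ _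
  have cW₁ : Continuous (Function.uncurry W₁) := continuous_expPoly _ _
  have cW₂ : Continuous (Function.uncurry W₂) := continuous_expPoly _ _
  have cΦ : ∀ Ψ : ℝ → ℝ → ℝ, Continuous (Function.uncurry Ψ) →
      Continuous fun q : ℝ × ℝ => Ψ (W q.1 q.2).re (W q.1 q.2).im := fun Ψ h =>
    h.comp ((Complex.continuous_re.comp cW).prodMk (Complex.continuous_im.comp cW))
  have cr₁ : Continuous fun q : ℝ × ℝ => (W₁ q.1 q.2).re := Complex.continuous_re.comp cW₁
  have ci₁ : Continuous fun q : ℝ × ℝ => (W₁ q.1 q.2).im := Complex.continuous_im.comp cW₁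
  have cr₂ : Continuous fun q : ℝ × ℝ => (W₂ q.1 q.2).re := Complex.continuous_re.comp cW₂
  have ci₂ : Continuous fun q : ℝ × ℝ => (W₂ q.1 q.2).im := Complex.continuous_im.comp cW₂
  have dxx := cΦ _ hcxx
  have dxy := cΦ _ hcxy
  have dyy := cΦ _ hcyy
  have dx := cΦ _ hcx
  have dy := cΦ _ hcy
  have hconv := convexOn_integral_of_laplacian_nonneg (a := 0) (b := 2 * π) (by positivity)
    (h := fun t θ => Φ (W t θ).re (W t θ).im)
    (h₁ := fun t θ => Φx (W t θ).re (W t θ).im * (W₁ t θ).re +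
      Φy (W t θ).re (W t θ).im * (W₁ t θ).im)
    (h₂ := fun t θ =>
      ((Φxx (W t θ).re (W t θ).im * (W₁ t θ).re + Φxy (W t θ).re (W t θ).im * (W₁ t θ).im) *
        (W₁ t θ).re + Φx (W t θ).re (W t θ).im * (W₂ t θ).re) +
      ((Φxy (W t θ).re (W t θ).im * (W₁ t θ).re + Φyy (W t θ).re (W t θ).im * (W₁ t θ).im) *
        (W₁ t θ).im + Φy (W t θ).re (W t θ).im * (W₂ t θ).im))
    (k₁ := fun t θ => Φy (W t θ).re (W t θ).im * (W₁ t θ).re -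
      Φx (W t θ).re (W t θ).im * (W₁ t θ).im)
    (k₂ := fun t θ =>
      ((Φxy (W t θ).re (W t θ).im * (Complex.I * W₁ t θ).re +
          Φyy (W t θ).re (W t θ).im * (Complex.I * W₁ t θ).im) *
        (W₁ t θ).re + Φy (W t θ).re (W t θ).im * (Complex.I * W₂ t θ).re) -
      ((Φxx (W t θ).re (W t θ).im * (Complex.I * W₁ t θ).re +
          Φxy (W t θ).re (W t θ).im * (Complex.I * W₁ t θ).im) *
        (W₁ t θ).im + Φx (W t θ).re (W t θ).im * (Complex.I * W₂ t θ).im))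
    (fun t θ => hΦ _ _ _ _ t (re_d _ _ _ (hWt t θ)) (im_d _ _ _ (hWt t θ)))
    (fun t θ => ((hΦx _ _ _ _ t (re_d _ _ _ (hWt t θ)) (im_d _ _ _ (hWt t θ))).mul
        (re_d _ _ _ (hW₁t t θ))).add
      ((hΦy _ _ _ _ t (re_d _ _ _ (hWt t θ)) (im_d _ _ _ (hWt t θ))).mul
        (im_d _ _ _ (hW₁t t θ))))
    (fun t θ => ((hΦy _ _ _ _ θ (re_d _ _ _ (hWθ t θ)) (im_d _ _ _ (hWθ t θ))).mul
        (re_d _ _ _ (hW₁θ t θ))).sub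
      ((hΦx _ _ _ _ θ (re_d _ _ _ (hWθ t θ)) (im_d _ _ _ (hWθ t θ))).mul
        (im_d _ _ _ (hW₁θ t θ))))
    (cΦ _ hc)
    (by simp only [Function.uncurry_def]; fun_prop)
    (by simp only [Function.uncurry_def]; fun_prop)
    (by
      simp only [Function.uncurry_def, Complex.mul_re, Complex.mul_im, Complex.I_re, Complex.I_im]
      fun_prop)
    (fun t => by simp only [hW, hW₁, expPoly_two_pi])
    (fun t θ => by
      have := mul_nonneg (hlap (W t θ).re (W t θ).im)
        (add_nonneg (sq_nonneg (W₁ t θ).re) (sq_nonneg (W₁ t θ).im))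
      simp only [Complex.mul_re, Complex.mul_im, Complex.I_re, Complex.I_im]
      linarith)
  set m : ℝ → ℝ := fun t => ∫ θ in (0 : ℝ)..2 * π, Φ (W t θ).re (W t θ).im with hm
  have hlim : Filter.Tendsto m Filter.atBot (nhds (2 * π * Φ (c 0).re (c 0).im)) := by
    let G : ℝ → ℝ → ℂ := fun r θ => ∑ k ∈ range (M + 1), c k * (r * Complex.exp (θ * Complex.I)) ^ k
    have hG : Continuous (Function.uncurry G) := by
      simp only [G, Function.uncurry_def]; fun_prop
    have hΦG : Continuous (Function.uncurry fun r θ => Φ (G r θ).re (G r θ).im) :=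
      hc.comp ((Complex.continuous_re.comp hG).prodMk (Complex.continuous_im.comp hG))
    have hcont : Continuous fun r => ∫ θ in (0 : ℝ)..2 * π, Φ (G r θ).re (G r θ).im :=
      intervalIntegral.continuous_parametric_intervalIntegral_of_continuous' hΦG _ _
    have h0 : ∫ θ in (0 : ℝ)..2 * π, Φ (G 0 θ).re (G 0 θ).im = 2 * π * Φ (c 0).re (c 0).im := by
      have : ∀ θ, G 0 θ = c 0 := fun θ => by simp [G, sum_range_succ']
      simp [this]
    rw [← h0]
    refine ((hcont.tendsto 0).comp Real.tendsto_exp_atBot).congr fun t => ?_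
    have : ∀ θ, G (rexp t) θ = W t θ := fun θ => by
      simp only [G, hW, expPoly]
      refine sum_congr rfl fun k _ => ?_
      rw [Complex.ofReal_exp, ← Complex.exp_add, ← Complex.exp_nat_mul]
    simp [this, hm]
  have hhalf : Filter.Tendsto (fun s : ℝ => m (s / 2)) Filter.atBot
      (nhds (2 * π * Φ (c 0).re (c 0).im)) :=
    hlim.comp (Filter.tendsto_id.atBot_div_const two_pos)
  have hle : ∀ s : ℝ, m (s / 2) ≤ 1 / 2 * m s + 1 / 2 * m 0 := fun s => by
    have := hconv.2 (Set.mem_univ s) (Set.mem_univ 0) (by norm_num : (0 : ℝ) ≤ 1 / 2)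
      (by norm_num : (0 : ℝ) ≤ 1 / 2) (by norm_num)
    simp only [smul_eq_mul, mul_zero, add_zero] at this
    rwa [show 1 / 2 * s = s / 2 by ring] at this
  have := le_of_tendsto_of_tendsto' hhalf ((hlim.const_mul (1 / 2)).add_const (1 / 2 * m 0)) hle
  change _ ≤ m 0
  linarith

theorem hasDerivAt_rpow_curve {S : ℝ → ℝ} {S' s : ℝ} (hS : HasDerivAt S S' s) (hpos : 0 < S s)
    (β : ℝ) : HasDerivAt (fun s => S s ^ β) (β * S s ^ (β - 1) * S') s :=
  (hS.rpow_const (p := β) (Or.inl hpos.ne')).congr_deriv (by ring)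

theorem hasDerivAt_const_add_sq_rpow {ε : ℝ} (hε : 0 < ε) (β : ℝ) {u : ℝ → ℝ} {u' s : ℝ}
    (hu : HasDerivAt u u' s) : HasDerivAt (fun s => (ε + u s ^ 2) ^ β)
      (β * (ε + u s ^ 2) ^ (β - 1) * (2 * u s * u')) s := by
  have h : HasDerivAt (fun s => ε + u s ^ 2) (2 * u s * u') s :=
    ((hu.fun_pow 2).const_add ε).congr_deriv (by simp)
  exact hasDerivAt_rpow_curve h (by positivity) β

theorem hasDerivAt_const_add_sq_add_sq_rpow {ε : ℝ} (hε : 0 < ε) (β : ℝ) {u v : ℝ → ℝ}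
    {u' v' s : ℝ} (hu : HasDerivAt u u' s) (hv : HasDerivAt v v' s) :
    HasDerivAt (fun s => (ε + (u s ^ 2 + v s ^ 2)) ^ β)
      (β * (ε + (u s ^ 2 + v s ^ 2)) ^ (β - 1) * (2 * u s * u' + 2 * v s * v')) s := by
  have h : HasDerivAt (fun s => ε + (u s ^ 2 + v s ^ 2)) (2 * u s * u' + 2 * v s * v') s :=
    (((hu.fun_pow 2).fun_add (hv.fun_pow 2)).const_add ε).congr_deriv (by simp)
  exact hasDerivAt_rpow_curve h (by positivity) β

theorem continuous_const_add_sq_rpow {ε : ℝ} (hε : 0 < ε) (β : ℝ) :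
    Continuous fun q : ℝ × ℝ => (ε + q.1 ^ 2) ^ β :=
  Continuous.rpow_const (by fun_prop) fun q => Or.inl (by positivity)

theorem continuous_const_add_sq_add_sq_rpow {ε : ℝ} (hε : 0 < ε) (β : ℝ) :
    Continuous fun q : ℝ × ℝ => (ε + (q.1 ^ 2 + q.2 ^ 2)) ^ β :=
  Continuous.rpow_const (by fun_prop) fun q => Or.inl (by positivity)

set_option maxHeartbeats 1000000 in
theorem integral_expPoly_le_of_le_two_aux {b ε : ℝ} (hb : 1 / 2 < b) (hb1 : b ≤ 1) (hε : 0 < ε)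
    (c : ℕ → ℂ) (M : ℕ) (hc0 : (c 0).im = 0) :
    ∫ θ in (0 : ℝ)..2 * π, (ε + ((expPoly c (M + 1) 0 θ).re ^ 2 +
        (expPoly c (M + 1) 0 θ).im ^ 2)) ^ b ≤
      2 / (2 * b - 1) * ∫ θ in (0 : ℝ)..2 * π, (ε + (expPoly c (M + 1) 0 θ).re ^ 2) ^ b := by
  set A := 2 / (2 * b - 1) with hA
  have hApos : A * (2 * b - 1) = 2 := by rw [hA]; field_simp [show 2 * b - 1 ≠ 0 by linarith]
  have hA1 : 2 ≤ A := by rw [hA, le_div_iff₀ (by linarith)]; linarith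
  have dX : ∀ (u : ℝ → ℝ) (u' s : ℝ), HasDerivAt u u' s → ∀ β : ℝ,
      HasDerivAt (fun s => (ε + u s ^ 2) ^ β)
        (β * (ε + u s ^ 2) ^ (β - 1) * (2 * u s * u')) s := fun u u' s hu β =>
    hasDerivAt_const_add_sq_rpow hε β hu
  have dS : ∀ (u v : ℝ → ℝ) (u' v' s : ℝ), HasDerivAt u u' s → HasDerivAt v v' s → ∀ β : ℝ,
      HasDerivAt (fun s => (ε + (u s ^ 2 + v s ^ 2)) ^ β)
        (β * (ε + (u s ^ 2 + v s ^ 2)) ^ (β - 1) * (2 * u s * u' + 2 * v s * v')) s :=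
    fun u v u' v' s hu hv β =>
    hasDerivAt_const_add_sq_add_sq_rpow hε β hu hv
  have cX := continuous_const_add_sq_rpow hε
  have cS := continuous_const_add_sq_add_sq_rpow hε
  have e2 : b - 1 - 1 = b - 2 := by ring
  have key := mean_value_subharmonic_expPoly
    (Φ := fun x y => A * (ε + x ^ 2) ^ b - (ε + (x ^ 2 + y ^ 2)) ^ b)
    (Φx := fun x y => 2 * b * (A * (x * (ε + x ^ 2) ^ (b - 1)) -
      x * (ε + (x ^ 2 + y ^ 2)) ^ (b - 1)))
    (Φy := fun x y => -(2 * b) * (y * (ε + (x ^ 2 + y ^ 2)) ^ (b - 1)))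
    (Φxx := fun x y => 2 * b * (A * ((ε + x ^ 2) ^ (b - 1) +
        2 * (b - 1) * x ^ 2 * (ε + x ^ 2) ^ (b - 2)) -
      ((ε + (x ^ 2 + y ^ 2)) ^ (b - 1) +
        2 * (b - 1) * x ^ 2 * (ε + (x ^ 2 + y ^ 2)) ^ (b - 2))))
    (Φxy := fun x y => -(2 * b) * (2 * (b - 1) * x * y * (ε + (x ^ 2 + y ^ 2)) ^ (b - 2)))
    (Φyy := fun x y => -(2 * b) * ((ε + (x ^ 2 + y ^ 2)) ^ (b - 1) +
        2 * (b - 1) * y ^ 2 * (ε + (x ^ 2 + y ^ 2)) ^ (b - 2)))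
    (fun u v u' v' s hu hv => (((dX u u' s hu b).const_mul A).fun_sub
      (dS u v u' v' s hu hv b)).congr_deriv (by ring))
    (fun u v u' v' s hu hv => ((((hu.fun_mul (dX u u' s hu (b - 1))).const_mul A).fun_sub
      (hu.fun_mul (dS u v u' v' s hu hv (b - 1)))).const_mul (2 * b)).congr_deriv (by
        rw [e2]; ring))
    (fun u v u' v' s hu hv =>
      ((hv.fun_mul (dS u v u' v' s hu hv (b - 1))).const_mul (-(2 * b))).congr_deriv (by
        rw [e2]; ring))
    (by simp only [Function.uncurry_def]; have := cX b; have := cS b; fun_prop)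
    (by simp only [Function.uncurry_def]; have := cX (b - 1); have := cS (b - 1); fun_prop)
    (by simp only [Function.uncurry_def]; have := cS (b - 1); fun_prop)
    (by
      simp only [Function.uncurry_def]
      have := cX (b - 1); have := cS (b - 1); have := cX (b - 2); have := cS (b - 2); fun_prop)
    (by simp only [Function.uncurry_def]; have := cS (b - 2); fun_prop)
    (by simp only [Function.uncurry_def]; have := cS (b - 1); have := cS (b - 2); fun_prop)
    (fun x y => by
      have hX : 0 < ε + x ^ 2 := by positivity
      have hS : 0 < ε + (x ^ 2 + y ^ 2) := by positivity
      have h1 : (ε + (x ^ 2 + y ^ 2)) ^ (b - 1) ≤ (ε + x ^ 2) ^ (b - 1) :=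
        rpow_le_rpow_of_nonpos hX (by nlinarith [sq_nonneg y]) (by linarith)
      have h2 : (ε + x ^ 2) ^ (b - 1) = (ε + x ^ 2) * (ε + x ^ 2) ^ (b - 2) := by
        nth_rewrite 2 [← rpow_one (ε + x ^ 2)]
        rw [← rpow_add hX]; congr 1; ring
      have h3 : 0 < (ε + x ^ 2) ^ (b - 2) := by positivity
      have h4 : 0 < (ε + (x ^ 2 + y ^ 2)) ^ (b - 2) := by positivity
      set X := (ε + x ^ 2) ^ (b - 1)
      set S := (ε + (x ^ 2 + y ^ 2)) ^ (b - 1)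
      set X' := (ε + x ^ 2) ^ (b - 2)
      set S' := (ε + (x ^ 2 + y ^ 2)) ^ (b - 2)
      have h5 : (2 * b - 1) * X ≤ X + 2 * (b - 1) * x ^ 2 * X' := by
        have : 0 ≤ (1 - b) * (ε * X') := mul_nonneg (by linarith) (by positivity)
        rw [h2]; nlinarith
      have h6 : 0 ≤ (1 - b) * ((x ^ 2 + y ^ 2) * S') := mul_nonneg (by linarith) (by positivity)
      have h7 := mul_le_mul_of_nonneg_left h5 (by linarith : (0 : ℝ) ≤ A)
      rw [← mul_assoc, hApos] at h7
      have h8 : 0 ≤ A * (X + 2 * (b - 1) * x ^ 2 * X') - 2 * S -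
          2 * (b - 1) * (x ^ 2 + y ^ 2) * S' := by nlinarith
      have := mul_nonneg (by linarith : (0 : ℝ) ≤ 2 * b) h8
      linarith) c M
  have hW : Continuous fun θ => expPoly c (M + 1) 0 θ :=
    (continuous_expPoly c (M + 1)).comp (by fun_prop : Continuous fun θ : ℝ => ((0 : ℝ), θ))
  have hre := Complex.continuous_re.comp hW
  have him := Complex.continuous_im.comp hW
  have i1 : Continuous fun θ => (ε + (expPoly c (M + 1) 0 θ).re ^ 2) ^ b :=
    (cX b).comp (hre.prodMk him)
  have i2 : Continuous fun θ => (ε + ((expPoly c (M + 1) 0 θ).re ^ 2 +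
      (expPoly c (M + 1) 0 θ).im ^ 2)) ^ b := (cS b).comp (hre.prodMk him)
  rw [intervalIntegral.integral_sub ((i1.const_mul A).intervalIntegrable _ _)
    (i2.intervalIntegrable _ _), intervalIntegral.integral_const_mul] at key
  have : 0 ≤ 2 * π * (A * (ε + (c 0).re ^ 2) ^ b - (ε + ((c 0).re ^ 2 + (c 0).im ^ 2)) ^ b) := by
    rw [hc0]
    have : 0 < (ε + (c 0).re ^ 2) ^ b := by positivity
    have : 0 ≤ A * (ε + (c 0).re ^ 2) ^ b - (ε + ((c 0).re ^ 2 + 0 ^ 2)) ^ b := by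
      simp only [ne_eq, OfNat.ofNat_ne_zero, not_false_eq_true, zero_pow, add_zero]
      nlinarith
    positivity
  linarith

set_option maxHeartbeats 1000000 in
theorem integral_expPoly_le_of_two_le_aux {b ε : ℝ} (hb1 : 1 ≤ b) (hε : 0 < ε)
    (c : ℕ → ℂ) (M : ℕ) (hc0 : (c 0).im = 0) :
    ∫ θ in (0 : ℝ)..2 * π, (ε + ((expPoly c (M + 1) 0 θ).re ^ 2 +
        (expPoly c (M + 1) 0 θ).im ^ 2)) ^ b ≤
      2 * b ^ 2 * (∫ θ in (0 : ℝ)..2 * π, (expPoly c (M + 1) 0 θ).re ^ 2 *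
        (ε + ((expPoly c (M + 1) 0 θ).re ^ 2 + (expPoly c (M + 1) 0 θ).im ^ 2)) ^ (b - 1)) +
      2 * π * ((ε + (c 0).re ^ 2) ^ b - (c 0).re ^ 2 * (ε + (c 0).re ^ 2) ^ (b - 1)) := by
  have dS : ∀ (u v : ℝ → ℝ) (u' v' s : ℝ), HasDerivAt u u' s → HasDerivAt v v' s → ∀ β : ℝ,
      HasDerivAt (fun s => (ε + (u s ^ 2 + v s ^ 2)) ^ β)
        (β * (ε + (u s ^ 2 + v s ^ 2)) ^ (β - 1) * (2 * u s * u' + 2 * v s * v')) s :=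
    fun u v u' v' s hu hv β =>
    hasDerivAt_const_add_sq_add_sq_rpow hε β hu hv
  have cS := continuous_const_add_sq_add_sq_rpow hε
  have e2 : b - 1 - 1 = b - 2 := by ring
  have e3 : b - 2 - 1 = b - 3 := by ring
  set A := 2 * b ^ 2 with hA
  have dsq : ∀ (u : ℝ → ℝ) (u' s : ℝ), HasDerivAt u u' s →
      HasDerivAt (fun s => u s ^ 2) (2 * u s * u') s := fun u u' s hu =>
    (hu.pow 2).congr_deriv (by simp)
  have key := mean_value_subharmonic_expPoly
    (Φ := fun x y => A * (x ^ 2 * (ε + (x ^ 2 + y ^ 2)) ^ (b - 1)) - (ε + (x ^ 2 + y ^ 2)) ^ b)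
    (Φx := fun x y => A * (2 * x * (ε + (x ^ 2 + y ^ 2)) ^ (b - 1) +
        2 * (b - 1) * (x ^ 2 * x * (ε + (x ^ 2 + y ^ 2)) ^ (b - 2))) -
      2 * b * (x * (ε + (x ^ 2 + y ^ 2)) ^ (b - 1)))
    (Φy := fun x y => A * (2 * (b - 1) * (x ^ 2 * y * (ε + (x ^ 2 + y ^ 2)) ^ (b - 2))) -
      2 * b * (y * (ε + (x ^ 2 + y ^ 2)) ^ (b - 1)))
    (Φxx := fun x y => A * (2 * (ε + (x ^ 2 + y ^ 2)) ^ (b - 1) +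
        10 * (b - 1) * x ^ 2 * (ε + (x ^ 2 + y ^ 2)) ^ (b - 2) +
        4 * (b - 1) * (b - 2) * x ^ 4 * (ε + (x ^ 2 + y ^ 2)) ^ (b - 3)) -
      2 * b * ((ε + (x ^ 2 + y ^ 2)) ^ (b - 1) +
        2 * (b - 1) * x ^ 2 * (ε + (x ^ 2 + y ^ 2)) ^ (b - 2)))
    (Φxy := fun x y => A * (4 * (b - 1) * x * y * (ε + (x ^ 2 + y ^ 2)) ^ (b - 2) +
        4 * (b - 1) * (b - 2) * x ^ 3 * y * (ε + (x ^ 2 + y ^ 2)) ^ (b - 3)) -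
      2 * b * (2 * (b - 1) * x * y * (ε + (x ^ 2 + y ^ 2)) ^ (b - 2)))
    (Φyy := fun x y => A * (2 * (b - 1) * x ^ 2 * (ε + (x ^ 2 + y ^ 2)) ^ (b - 2) +
        4 * (b - 1) * (b - 2) * x ^ 2 * y ^ 2 * (ε + (x ^ 2 + y ^ 2)) ^ (b - 3)) -
      2 * b * ((ε + (x ^ 2 + y ^ 2)) ^ (b - 1) +
        2 * (b - 1) * y ^ 2 * (ε + (x ^ 2 + y ^ 2)) ^ (b - 2)))
    (fun u v u' v' s hu hv => ((((dsq u u' s hu).fun_mul (dS u v u' v' s hu hv (b - 1))).const_mul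
      A).sub (dS u v u' v' s hu hv b)).congr_deriv (by rw [e2]; ring))
    (fun u v u' v' s hu hv =>
      (((((hu.const_mul 2).fun_mul (dS u v u' v' s hu hv (b - 1))).fun_add
        ((((dsq u u' s hu).fun_mul hu).fun_mul (dS u v u' v' s hu hv (b - 2))).const_mul
          (2 * (b - 1)))).const_mul A).fun_sub
        ((hu.fun_mul (dS u v u' v' s hu hv (b - 1))).const_mul (2 * b))).congr_deriv (by
        rw [e2, e3]; ring))
    (fun u v u' v' s hu hv =>
      ((((((dsq u u' s hu).fun_mul hv).fun_mul (dS u v u' v' s hu hv (b - 2))).const_mul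
          (2 * (b - 1))).const_mul A).fun_sub
        ((hv.fun_mul (dS u v u' v' s hu hv (b - 1))).const_mul (2 * b))).congr_deriv (by
        rw [e2, e3]; ring))
    (by simp only [Function.uncurry_def]; have := cS (b - 1); have := cS b; fun_prop)
    (by simp only [Function.uncurry_def]; have := cS (b - 1); have := cS (b - 2); fun_prop)
    (by simp only [Function.uncurry_def]; have := cS (b - 1); have := cS (b - 2); fun_prop)
    (by
      simp only [Function.uncurry_def]
      have := cS (b - 1); have := cS (b - 2); have := cS (b - 3); fun_prop)
    (by simp only [Function.uncurry_def]; have := cS (b - 2); have := cS (b - 3); fun_prop)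
    (by
      simp only [Function.uncurry_def]
      have := cS (b - 1); have := cS (b - 2); have := cS (b - 3); fun_prop)
    (fun x y => by
      have hS : 0 < ε + (x ^ 2 + y ^ 2) := by positivity
      have h1 : (ε + (x ^ 2 + y ^ 2)) ^ (b - 1) =
          (ε + (x ^ 2 + y ^ 2)) * (ε + (x ^ 2 + y ^ 2)) ^ (b - 2) := by
        nth_rewrite 2 [← rpow_one (ε + (x ^ 2 + y ^ 2))]
        rw [← rpow_add hS]; congr 1; ring
      have h2 : (ε + (x ^ 2 + y ^ 2)) ^ (b - 2) =
          (ε + (x ^ 2 + y ^ 2)) * (ε + (x ^ 2 + y ^ 2)) ^ (b - 3) := by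
        nth_rewrite 2 [← rpow_one (ε + (x ^ 2 + y ^ 2))]
        rw [← rpow_add hS]; congr 1; ring
      have h3 : 0 < (ε + (x ^ 2 + y ^ 2)) ^ (b - 3) := by positivity
      rw [h1, h2]
      set R := (ε + (x ^ 2 + y ^ 2)) ^ (b - 3)
      obtain ⟨d, hd⟩ : ∃ d, b = 1 + d := ⟨b - 1, by ring⟩
      have hd0 : 0 ≤ d := by linarith
      subst hd
      have hfac : ∀ s r : ℝ, s = ε + r → r = x ^ 2 + y ^ 2 →
          A * (2 * (s * (s * R)) + 12 * d * x ^ 2 * (s * R) +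
            4 * d * (d - 1) * x ^ 2 * r * R) -
          2 * (1 + d) * (2 * (s * (s * R)) + 2 * d * r * (s * R)) =
          R * (4 * (1 + d) * d * s * ε + A * (12 * d - 4 * d) * x ^ 2 * s +
            4 * A * d ^ 2 * x ^ 2 * r + 4 * A * d * x ^ 2 * ε) := by
        intro s r hs hr
        rw [hA]
        have : ε = s - r := by linarith
        rw [this]
        ring
      have := hfac _ _ rfl rfl
      have hnn : 0 ≤ R * (4 * (1 + d) * d * (ε + (x ^ 2 + y ^ 2)) * ε +
          A * (12 * d - 4 * d) * x ^ 2 * (ε + (x ^ 2 + y ^ 2)) +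
            4 * A * d ^ 2 * x ^ 2 * (x ^ 2 + y ^ 2) + 4 * A * d * x ^ 2 * ε) := by
        have : 0 ≤ 12 * d - 4 * d := by linarith
        positivity
      rw [← this] at hnn
      refine hnn.trans_eq ?_
      ring) c M
  have hW : Continuous fun θ => expPoly c (M + 1) 0 θ :=
    (continuous_expPoly c (M + 1)).comp (by fun_prop : Continuous fun θ : ℝ => ((0 : ℝ), θ))
  have hre : Continuous fun θ => (expPoly c (M + 1) 0 θ).re := Complex.continuous_re.comp hW
  have him : Continuous fun θ => (expPoly c (M + 1) 0 θ).im := Complex.continuous_im.comp hW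
  have i1 : Continuous fun θ => (expPoly c (M + 1) 0 θ).re ^ 2 *
      (ε + ((expPoly c (M + 1) 0 θ).re ^ 2 + (expPoly c (M + 1) 0 θ).im ^ 2)) ^ (b - 1) :=
    (hre.pow 2).mul ((cS (b - 1)).comp (hre.prodMk him))
  have i2 : Continuous fun θ => (ε + ((expPoly c (M + 1) 0 θ).re ^ 2 +
      (expPoly c (M + 1) 0 θ).im ^ 2)) ^ b := (cS b).comp (hre.prodMk him)
  rw [intervalIntegral.integral_sub ((i1.const_mul A).intervalIntegrable _ _)
    (i2.intervalIntegrable _ _), intervalIntegral.integral_const_mul, hc0] at key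
  have : 0 ≤ 2 * π * ((A - 1) * ((c 0).re ^ 2 * (ε + (c 0).re ^ 2) ^ (b - 1))) := by
    have : 0 ≤ A - 1 := by rw [hA]; nlinarith
    positivity
  simp only [ne_eq, OfNat.ofNat_ne_zero, not_false_eq_true, zero_pow, add_zero] at key
  linarith

theorem rpow_le_half_rpow_add {b X R : ℝ} (hb : 1 ≤ b) (hX : 0 ≤ X) (hR : 0 ≤ R) :
    2 * b ^ 2 * (X * R ^ (b - 1)) ≤
      1 / 2 * R ^ b + 2 * b ^ 2 * (4 * b ^ 2) ^ (b - 1) * X ^ b := by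
  have hpow : ∀ Y : ℝ, 0 ≤ Y → Y * Y ^ (b - 1) = Y ^ b := fun Y hY => by
    rw [← rpow_one_add' hY (by linarith)]; congr 1; ring
  by_cases h : 4 * b ^ 2 * X ≤ R
  · have h1 : 0 ≤ R ^ (b - 1) := by positivity
    have h2 := mul_le_mul_of_nonneg_right h h1
    rw [hpow R hR] at h2
    have h3 : 0 ≤ 2 * b ^ 2 * (4 * b ^ 2) ^ (b - 1) * X ^ b := by positivity
    linarith
  · push Not at h
    have h1 : R ^ (b - 1) ≤ (4 * b ^ 2) ^ (b - 1) * X ^ (b - 1) := by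
      rw [← mul_rpow (by positivity) hX]
      exact rpow_le_rpow hR h.le (by linarith)
    have h2 : 0 ≤ 1 / 2 * R ^ b := by positivity
    have h3 := mul_le_mul_of_nonneg_left h1 (by positivity : 0 ≤ 2 * b ^ 2 * X)
    rw [← hpow X hX]
    linarith

theorem continuous_integral_add_rpow {g k : ℝ → ℝ} (hg : Continuous g) (hk : Continuous k) {β : ℝ}
    (hβ : 0 ≤ β) : Continuous fun ε : ℝ => ∫ θ in (0 : ℝ)..2 * π, k θ * (ε + g θ) ^ β := by
  refine intervalIntegral.continuous_parametric_intervalIntegral_of_continuous' ?_ _ _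
  exact (hk.comp continuous_snd).mul (Continuous.rpow_const (by fun_prop) fun _ => Or.inr hβ)

/-- The inequality `‖F‖_p ≲ ‖Re F‖_p` for analytic polynomials with real constant term. -/
theorem exists_integral_norm_expPoly_le {p : ℝ} (hp : 1 < p) :
    ∃ A : ℝ, 0 ≤ A ∧ ∀ (c : ℕ → ℂ) (M : ℕ), (c 0).im = 0 →
      ∫ θ in (0 : ℝ)..2 * π, ‖expPoly c (M + 1) 0 θ‖ ^ p ≤
        A * ∫ θ in (0 : ℝ)..2 * π, |(expPoly c (M + 1) 0 θ).re| ^ p := by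
  obtain ⟨b, rfl⟩ : ∃ b, p = 2 * b := ⟨p / 2, by ring⟩
  have habs : ∀ x : ℝ, |x| ^ (2 * b) = (x ^ 2) ^ b := fun x => by
    rw [rpow_mul (abs_nonneg x)]; norm_num
  have hnorm : ∀ z : ℂ, ‖z‖ ^ (2 * b) = (z.re ^ 2 + z.im ^ 2) ^ b := fun z => by
    rw [rpow_mul (norm_nonneg z), rpow_two, Complex.sq_norm, Complex.normSq_apply]
    congr 1; ring
  simp only [habs, hnorm]
  have hW : ∀ c M, Continuous fun θ => expPoly c (M + 1) 0 θ := fun c M =>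
    (continuous_expPoly c (M + 1)).comp (by fun_prop : Continuous fun θ : ℝ => ((0 : ℝ), θ))
  have hre : ∀ c M, Continuous fun θ => (expPoly c (M + 1) 0 θ).re ^ 2 :=
    fun c M => (Complex.continuous_re.comp (hW c M)).pow 2
  have hR : ∀ c M, Continuous fun θ => (expPoly c (M + 1) 0 θ).re ^ 2 +
      (expPoly c (M + 1) 0 θ).im ^ 2 :=
    fun c M => (hre c M).add ((Complex.continuous_im.comp (hW c M)).pow 2)
  have hlim : ∀ φ : ℝ → ℝ, Continuous φ →
      Filter.Tendsto φ (nhdsWithin 0 (Set.Ioi 0)) (nhds (φ 0)) :=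
    fun φ hφ => (hφ.tendsto 0).mono_left nhdsWithin_le_nhds
  rcases le_total b 1 with hb1 | hb1
  · refine ⟨2 / (2 * b - 1), div_nonneg zero_le_two (by linarith), fun c M hc => ?_⟩
    have h1 := continuous_integral_add_rpow (hR c M) continuous_const (k := fun _ => 1)
      (β := b) (by linarith)
    have h2 := (continuous_integral_add_rpow (hre c M) continuous_const (k := fun _ => 1)
      (β := b) (by linarith)).const_mul (2 / (2 * b - 1))
    have := le_of_tendsto_of_tendsto (hlim _ h1) (hlim _ h2) (by
      filter_upwards [self_mem_nhdsWithin] with ε hε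
      simpa only [one_mul] using
        integral_expPoly_le_of_le_two_aux (by linarith) hb1 hε c M hc)
    simpa only [one_mul, zero_add] using this
  · refine ⟨2 * (2 * b ^ 2 * (4 * b ^ 2) ^ (b - 1)), by positivity, fun c M hc => ?_⟩
    have h1 := continuous_integral_add_rpow (hR c M) continuous_const (k := fun _ => 1)
      (β := b) (by linarith)
    have h2 := (continuous_integral_add_rpow (hR c M) (hre c M)
      (β := b - 1) (by linarith)).const_mul (2 * b ^ 2)
    have hr : ∀ β : ℝ, 0 ≤ β → Continuous fun ε : ℝ => (ε + (c 0).re ^ 2) ^ β := fun β hβ =>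
      Continuous.rpow_const (by fun_prop) fun _ => Or.inr hβ
    have h3 : Continuous fun ε : ℝ => 2 * π * ((ε + (c 0).re ^ 2) ^ b -
        (c 0).re ^ 2 * (ε + (c 0).re ^ 2) ^ (b - 1)) :=
      ((hr b (by linarith)).sub ((hr (b - 1) (by linarith)).const_mul _)).const_mul _
    have key := le_of_tendsto_of_tendsto (hlim _ h1) (hlim _ (h2.add h3)) (by
      filter_upwards [self_mem_nhdsWithin] with ε hε
      simpa only [one_mul, Pi.add_apply] using integral_expPoly_le_of_two_le_aux hb1 hε c M hc)
    have h0 : (c 0).re ^ 2 * ((c 0).re ^ 2) ^ (b - 1) = ((c 0).re ^ 2) ^ b := by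
      rw [← rpow_one_add' (sq_nonneg _) (by linarith)]; congr 1; ring
    simp only [Pi.add_apply, one_mul, zero_add, h0, sub_self, mul_zero, add_zero] at key
    have cRb : Continuous fun θ => ((expPoly c (M + 1) 0 θ).re ^ 2 +
        (expPoly c (M + 1) 0 θ).im ^ 2) ^ b :=
      (hR c M).rpow_const fun _ => Or.inr (by linarith)
    have cXb : Continuous fun θ => ((expPoly c (M + 1) 0 θ).re ^ 2) ^ b :=
      (hre c M).rpow_const fun _ => Or.inr (by linarith)
    have cXR : Continuous fun θ => (expPoly c (M + 1) 0 θ).re ^ 2 *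
        ((expPoly c (M + 1) 0 θ).re ^ 2 + (expPoly c (M + 1) 0 θ).im ^ 2) ^ (b - 1) :=
      (hre c M).mul ((hR c M).rpow_const fun _ => Or.inr (by linarith))
    have young := intervalIntegral.integral_mono (μ := volume) (a := 0) (b := 2 * π)
      (by positivity)
      ((cXR.const_mul (2 * b ^ 2)).intervalIntegrable _ _)
      (((cRb.const_mul (1 / 2)).add
        (cXb.const_mul (2 * b ^ 2 * (4 * b ^ 2) ^ (b - 1)))).intervalIntegrable _ _)
      (fun θ => rpow_le_half_rpow_add hb1 (sq_nonneg _) (by positivity))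
    simp only [Pi.add_apply] at young
    rw [intervalIntegral.integral_const_mul, intervalIntegral.integral_add
      ((cRb.const_mul (1 / 2)).intervalIntegrable _ _)
      ((cXb.const_mul (2 * b ^ 2 * (4 * b ^ 2) ^ (b - 1))).intervalIntegrable _ _),
      intervalIntegral.integral_const_mul, intervalIntegral.integral_const_mul] at young
    linarith

/-- Lebesgue measure on one period. -/
noncomputable abbrev periodMeasure : Measure ℝ := volume.restrict (Set.Ioc 0 (2 * π))

theorem eLpNorm_periodMeasure_eq {E : Type*} [NormedAddCommGroup E] {p : ℝ} (hp : 0 < p)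
    {f : ℝ → E} (hf : MemLp f (ENNReal.ofReal p) periodMeasure) :
    eLpNorm f (ENNReal.ofReal p) periodMeasure =
      ENNReal.ofReal ((∫ θ in (0 : ℝ)..2 * π, ‖f θ‖ ^ p) ^ (1 / p)) := by
  rw [hf.eLpNorm_eq_integral_rpow_norm (by simpa using hp) ENNReal.ofReal_ne_top,
    intervalIntegral.integral_of_le (by positivity), ENNReal.toReal_ofReal hp.le, one_div]

theorem memLp_periodMeasure_of_continuous {E : Type*} [NormedAddCommGroup E]
    [SecondCountableTopologyEither ℝ E] {f : ℝ → E}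
    (hf : Continuous f) (q : ENNReal) : MemLp f q periodMeasure := by
  obtain ⟨C, hC⟩ := (isCompact_Icc (a := 0) (b := 2 * π)).exists_bound_of_continuousOn
    hf.continuousOn
  refine MemLp.of_bound hf.aestronglyMeasurable C ?_
  filter_upwards [ae_restrict_mem measurableSet_Ioc] with x hx
  exact hC x (Set.Ioc_subset_Icc_self hx)

theorem exists_eLpNorm_expPoly_le {p : ℝ} (hp : 1 < p) :
    ∃ A : NNReal, ∀ (c : ℕ → ℂ) (M : ℕ), (c 0).im = 0 →
      eLpNorm (fun θ => expPoly c (M + 1) 0 θ) (ENNReal.ofReal p) periodMeasure ≤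
        A * eLpNorm (fun θ => (expPoly c (M + 1) 0 θ).re) (ENNReal.ofReal p) periodMeasure := by
  obtain ⟨A, hA, h⟩ := exists_integral_norm_expPoly_le hp
  refine ⟨(A ^ (1 / p)).toNNReal, fun c M hc => ?_⟩
  have hW : Continuous fun θ => expPoly c (M + 1) 0 θ :=
    (continuous_expPoly c (M + 1)).comp (by fun_prop : Continuous fun θ : ℝ => ((0 : ℝ), θ))
  have hre : Continuous fun θ => (expPoly c (M + 1) 0 θ).re := Complex.continuous_re.comp hW
  rw [eLpNorm_periodMeasure_eq (by linarith) (memLp_periodMeasure_of_continuous hW _),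
    eLpNorm_periodMeasure_eq (by linarith) (memLp_periodMeasure_of_continuous hre _)]
  change _ ≤ ENNReal.ofReal _ * _
  have hnn : ∀ (E : Type) [NormedAddCommGroup E] (f : ℝ → E),
      0 ≤ ∫ θ in (0 : ℝ)..2 * π, ‖f θ‖ ^ p := fun E _ f =>
    intervalIntegral.integral_nonneg (by positivity) fun θ _ => by positivity
  rw [← ENNReal.ofReal_mul (by positivity), ← mul_rpow hA (hnn _ _)]
  exact ENNReal.ofReal_le_ofReal (rpow_le_rpow (hnn _ _) (h c M hc) (by positivity))

/-- The trigonometric polynomial with coefficients `d` and frequencies in `s`. -/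
noncomputable def trigSum (s : Finset ℤ) (d : ℤ → ℂ) (θ : ℝ) : ℂ :=
  ∑ k ∈ s, d k * Complex.exp (k * (θ * Complex.I))

theorem continuous_trigSum (s : Finset ℤ) (d : ℤ → ℂ) : Continuous (trigSum s d) := by
  unfold trigSum
  fun_prop

theorem sum_Icc_neg_natCast {E : Type*} [AddCommMonoid E] (g : ℤ → E) (M : ℕ) :
    ∑ k ∈ Icc (-(M : ℤ)) M, g k =
      g 0 + ∑ k ∈ range M, (g ((k : ℤ) + 1) + g (-((k : ℤ) + 1))) := by
  induction M with
  | zero => simp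
  | succ M ih =>
    have : Icc (-((M + 1 : ℕ) : ℤ)) ((M + 1 : ℕ) : ℤ) =
        insert ((M : ℤ) + 1) (insert (-((M : ℤ) + 1)) (Icc (-(M : ℤ)) M)) := by
      ext k; simp only [mem_insert, mem_Icc]; push_cast; omega
    rw [this, sum_insert (by simp only [mem_insert, mem_Icc]; omega),
      sum_insert (by simp only [mem_Icc]; omega), ih, sum_range_succ]
    abel

theorem sum_Icc_zero_natCast {E : Type*} [AddCommMonoid E] (g : ℤ → E) (M : ℕ) :
    ∑ k ∈ Icc (0 : ℤ) M, g k = ∑ k ∈ range (M + 1), g k := by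
  induction M with
  | zero => simp
  | succ M ih =>
    have : Icc 0 ((M + 1 : ℕ) : ℤ) = insert (((M + 1 : ℕ) : ℤ)) (Icc 0 (M : ℤ)) := by
      ext k; simp only [mem_insert, mem_Icc]; push_cast; omega
    rw [this, sum_insert (by simp only [mem_Icc]; push_cast; omega), ih, sum_range_succ _ (M + 1),
      add_comm]

/-- Taylor coefficients of the analytic polynomial whose real part on the circle is the real part
of the trigonometric polynomial with coefficients `d`. -/
noncomputable def analyticCoeff (d : ℤ → ℂ) (k : ℕ) : ℂ :=
  if k = 0 then ((d 0).re : ℂ) else d k + (starRingEnd ℂ) (d (-k))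

theorem re_expPoly_analyticCoeff (d : ℤ → ℂ) (M : ℕ) (θ : ℝ) :
    (expPoly (analyticCoeff d) (M + 1) 0 θ).re = (trigSum (Icc (-(M : ℤ)) M) d θ).re := by
  unfold expPoly trigSum
  rw [sum_Icc_neg_natCast, sum_range_succ', Complex.add_re, Complex.add_re, add_comm,
    Complex.re_sum, Complex.re_sum]
  congr 1
  · simp [analyticCoeff]
  · refine sum_congr rfl fun k _ => ?_
    have h : (starRingEnd ℂ) (d (-((k : ℤ) + 1)) *
        Complex.exp (((-((k : ℤ) + 1) : ℤ) : ℂ) * (θ * Complex.I))) =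
        (starRingEnd ℂ) (d (-((k : ℤ) + 1))) *
          Complex.exp (((k + 1 : ℕ) : ℂ) * (θ * Complex.I)) := by
      rw [map_mul, ← Complex.exp_conj]
      congr 2
      simp only [map_mul, map_intCast, Complex.conj_ofReal, Complex.conj_I]
      push_cast
      ring
    rw [Complex.add_re, ← Complex.conj_re (d (-((k : ℤ) + 1)) * _), h, ← Complex.add_re]
    congr 1
    simp only [analyticCoeff, Nat.succ_ne_zero, if_false]
    push_cast
    simp only [zero_add]
    ring

theorem expPoly_add_I_mul_expPoly (d : ℤ → ℂ) (M : ℕ) (θ : ℝ) :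
    expPoly (analyticCoeff d) (M + 1) 0 θ +
      Complex.I * expPoly (analyticCoeff fun k => -Complex.I * d k) (M + 1) 0 θ + d 0 =
      2 * trigSum (Icc (0 : ℤ) M) d θ := by
  unfold expPoly trigSum
  rw [sum_Icc_zero_natCast, sum_range_succ', sum_range_succ', sum_range_succ', mul_add Complex.I (∑ k ∈ range M, _),
    mul_add 2 (∑ k ∈ range M, _), mul_sum, mul_sum]
  have h0 : analyticCoeff d 0 + Complex.I * analyticCoeff (fun k => -Complex.I * d k) 0 = d 0 := by
    simp only [analyticCoeff, if_true]
    apply Complex.ext <;> simp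
  have h1 : ∀ k : ℕ, analyticCoeff d (k + 1) +
      Complex.I * analyticCoeff (fun k => -Complex.I * d k) (k + 1) = 2 * d ((k + 1 : ℕ) : ℤ) := by
    intro k
    simp only [analyticCoeff, Nat.succ_ne_zero, if_false, map_mul, map_neg, Complex.conj_I]
    linear_combination (-d ((k + 1 : ℕ) : ℤ) +
      (starRingEnd ℂ) (d (-((k + 1 : ℕ) : ℤ)))) * Complex.I_sq
  have h2 : ∑ k ∈ range M, (analyticCoeff d (k + 1) *
        Complex.exp (((k + 1 : ℕ) : ℂ) * (((0 : ℝ) : ℂ) + θ * Complex.I))) +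
      ∑ k ∈ range M, Complex.I * (analyticCoeff (fun k => -Complex.I * d k) (k + 1) *
        Complex.exp (((k + 1 : ℕ) : ℂ) * (((0 : ℝ) : ℂ) + θ * Complex.I))) =
      ∑ k ∈ range M, 2 * (d ((k + 1 : ℕ) : ℤ) *
        Complex.exp ((((k + 1 : ℕ) : ℤ) : ℂ) * (θ * Complex.I))) := by
    rw [← sum_add_distrib]
    refine sum_congr rfl fun k _ => ?_
    rw [← mul_assoc 2, ← h1 k]
    push_cast
    simp only [zero_add]
    ring
  rw [← h2]
  simp only [Nat.cast_zero, zero_mul, Complex.exp_zero, mul_one, Int.cast_zero]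
  linear_combination h0

theorem integral_exp_int_mul {k : ℤ} (hk : k ≠ 0) :
    ∫ θ in (0 : ℝ)..2 * π, Complex.exp (k * (θ * Complex.I)) = 0 := by
  have hc : (k : ℂ) * Complex.I ≠ 0 := mul_ne_zero (by exact_mod_cast hk) Complex.I_ne_zero
  have h := integral_exp_mul_complex (a := 0) (b := 2 * π) hc
  have e : ((k : ℂ) * Complex.I) * ((2 * π : ℝ) : ℂ) = k * (2 * π * Complex.I) := by
    push_cast; ring
  rw [e, Complex.exp_int_mul_two_pi_mul_I] at h
  simp only [Complex.ofReal_zero, mul_zero, Complex.exp_zero, sub_self, zero_div] at h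
  rw [← h]
  congr 1; ext θ; congr 1; ring

theorem integral_trigSum {s : Finset ℤ} (hs : 0 ∈ s) (d : ℤ → ℂ) :
    ∫ θ in (0 : ℝ)..2 * π, trigSum s d θ = 2 * π * d 0 := by
  unfold trigSum
  rw [intervalIntegral.integral_finsetSum
    (fun k _ => (by fun_prop : Continuous _).intervalIntegrable _ _)]
  rw [sum_eq_single_of_mem 0 hs]
  · simp
  · intro k _ hk
    rw [intervalIntegral.integral_const_mul, integral_exp_int_mul hk, mul_zero]

theorem eLpNorm_const_coeff_zero_le {q : ENNReal} (hq : 1 ≤ q) {s : Finset ℤ} (hs : 0 ∈ s)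
    (d : ℤ → ℂ) :
    eLpNorm (fun _ : ℝ => d 0) q periodMeasure ≤ eLpNorm (trigSum s d) q periodMeasure := by
  have hμ : periodMeasure Set.univ = ENNReal.ofReal (2 * π) := by simp [periodMeasure]
  have hμ0 : periodMeasure ≠ 0 := by
    intro h; rw [h] at hμ; simp at hμ; linarith [pi_pos]
  have hμt : periodMeasure Set.univ ≠ ⊤ := by rw [hμ]; exact ENNReal.ofReal_ne_top
  have hμn : periodMeasure Set.univ ≠ 0 := by simpa using hμ0
  have h1 : periodMeasure Set.univ * ‖d 0‖ₑ ≤ eLpNorm (trigSum s d) 1 periodMeasure := by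
    have h2 := integral_trigSum hs d
    rw [intervalIntegral.integral_of_le (by positivity)] at h2
    have h3 := enorm_integral_le_lintegral_enorm (μ := periodMeasure) (trigSum s d)
    rw [h2, enorm_mul] at h3
    rw [eLpNorm_one_eq_lintegral_enorm, hμ]
    refine le_trans (le_of_eq ?_) h3
    congr 1
    rw [← ofReal_norm]
    congr 1
    simp [abs_of_pos pi_pos]
  have h2 := eLpNorm_le_eLpNorm_mul_rpow_measure_univ (μ := periodMeasure) (p := 1) (q := q) hq
    (continuous_trigSum s d).aestronglyMeasurable
  rw [eLpNorm_const _ (by positivity) hμ0]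
  have h4 := h1.trans h2
  have h5 : periodMeasure Set.univ ^ (1 / q.toReal) *
      periodMeasure Set.univ ^ (1 / ENNReal.toReal 1 - 1 / q.toReal) = periodMeasure Set.univ := by
    rw [← ENNReal.rpow_add _ _ hμn hμt]; simp
  have h6 : periodMeasure Set.univ ^ (1 / ENNReal.toReal 1 - 1 / q.toReal) ≠ 0 :=
    (ENNReal.rpow_pos (pos_iff_ne_zero.2 hμn) hμt).ne'
  have h7 : periodMeasure Set.univ ^ (1 / ENNReal.toReal 1 - 1 / q.toReal) ≠ ⊤ :=
    ENNReal.rpow_ne_top_of_ne_zero hμn hμt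
  rw [← ENNReal.mul_le_mul_iff_left h6 h7]
  calc _ = (periodMeasure Set.univ ^ (1 / q.toReal) *
      periodMeasure Set.univ ^ (1 / ENNReal.toReal 1 - 1 / q.toReal)) * ‖d 0‖ₑ := by ring
    _ ≤ _ := by rw [h5]; exact h4

theorem exists_eLpNorm_trigSum_Icc_zero_le {p : ℝ} (hp : 1 < p) :
    ∃ A : NNReal, ∀ (d : ℤ → ℂ) (M : ℕ),
      eLpNorm (trigSum (Icc (0 : ℤ) M) d) (ENNReal.ofReal p) periodMeasure ≤
        A * eLpNorm (trigSum (Icc (-(M : ℤ)) M) d) (ENNReal.ofReal p) periodMeasure := by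
  obtain ⟨A, hA⟩ := exists_eLpNorm_expPoly_le hp
  have hp1 : (1 : ENNReal) ≤ ENNReal.ofReal p := by
    rw [← ENNReal.ofReal_one]; exact ENNReal.ofReal_le_ofReal hp.le
  refine ⟨A + A + 1, fun d M => ?_⟩
  set q := ENNReal.ofReal p
  have hcont : ∀ c : ℕ → ℂ, Continuous fun θ => expPoly c (M + 1) 0 θ := fun c =>
    (continuous_expPoly c (M + 1)).comp (by fun_prop : Continuous fun θ : ℝ => ((0 : ℝ), θ))
  set N := eLpNorm (trigSum (Icc (-(M : ℤ)) M) d) q periodMeasure with hN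
  have hF : ∀ d' : ℤ → ℂ, (∀ θ, |(trigSum (Icc (-(M : ℤ)) M) d' θ).re| ≤
      ‖trigSum (Icc (-(M : ℤ)) M) d θ‖) →
      eLpNorm (fun θ => expPoly (analyticCoeff d') (M + 1) 0 θ) q periodMeasure ≤ A * N := by
    intro d' hd'
    refine (hA _ _ (by simp [analyticCoeff])).trans ?_
    gcongr
    refine eLpNorm_mono fun θ => ?_
    rw [re_expPoly_analyticCoeff]
    exact hd' θ
  have h1 := hF d fun θ => Complex.abs_re_le_norm _
  have h2 := hF (fun k => -Complex.I * d k) fun θ => by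
    refine (Complex.abs_re_le_norm _).trans (le_of_eq ?_)
    have : trigSum (Icc (-(M : ℤ)) M) (fun k => -Complex.I * d k) θ =
        -Complex.I * trigSum (Icc (-(M : ℤ)) M) d θ := by
      simp only [trigSum, mul_sum, mul_assoc]
    rw [this]; simp
  have h3 := eLpNorm_const_coeff_zero_le hp1 (s := Icc (-(M : ℤ)) M) (by simp) d
  have hle : eLpNorm (trigSum (Icc (0 : ℤ) M) d) q periodMeasure ≤
      eLpNorm ((fun θ => expPoly (analyticCoeff d) (M + 1) 0 θ) +
        (fun θ => Complex.I * expPoly (analyticCoeff fun k => -Complex.I * d k) (M + 1) 0 θ) +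
        fun _ => d 0) q periodMeasure := by
    refine eLpNorm_mono fun θ => ?_
    simp only [Pi.add_apply]
    rw [expPoly_add_I_mul_expPoly, norm_mul]
    have := norm_nonneg (trigSum (Icc (0 : ℤ) M) d θ)
    simp only [Complex.norm_ofNat]
    linarith
  refine hle.trans ((eLpNorm_add_le (((hcont _).add
    ((hcont _).const_mul _)).aestronglyMeasurable) aestronglyMeasurable_const hp1).trans ?_)
  have hI : eLpNorm (fun θ => Complex.I *
      expPoly (analyticCoeff fun k => -Complex.I * d k) (M + 1) 0 θ) q periodMeasure ≤ A * N := by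
    refine le_trans (eLpNorm_mono fun θ => ?_) h2
    simp
  have := (eLpNorm_add_le (μ := periodMeasure) (hcont (analyticCoeff d)).aestronglyMeasurable
    ((hcont (analyticCoeff fun k => -Complex.I * d k)).const_mul Complex.I).aestronglyMeasurable
    hp1).trans (add_le_add h1 hI)
  refine (add_le_add this h3).trans (le_of_eq ?_)
  push_cast
  ring

/-- Boundedness of the Riesz projection on trigonometric polynomials. -/
theorem exists_eLpNorm_trigSum_filter_nonneg_le {p : ℝ} (hp : 1 < p) :
    ∃ A : NNReal, ∀ (s : Finset ℤ) (d : ℤ → ℂ),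
      eLpNorm (trigSum {k ∈ s | 0 ≤ k} d) (ENNReal.ofReal p) periodMeasure ≤
        A * eLpNorm (trigSum s d) (ENNReal.ofReal p) periodMeasure := by
  obtain ⟨A, hA⟩ := exists_eLpNorm_trigSum_Icc_zero_le hp
  refine ⟨A, fun s d => ?_⟩
  let M := s.sup Int.natAbs
  have hM : ∀ k ∈ s, -(M : ℤ) ≤ k ∧ k ≤ M := fun k hk => by
    have : k.natAbs ≤ M := le_sup (f := Int.natAbs) hk
    omega
  let d' : ℤ → ℂ := fun k => if k ∈ s then d k else 0
  have hsum : ∀ t u : Finset ℤ, t ⊆ u → (∀ k ∈ t, k ∈ s) → (∀ k ∈ u, k ∈ s → k ∈ t) →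
      trigSum t d = trigSum u d' := by
    intro t u htu hts hut
    ext θ
    unfold trigSum
    refine (sum_congr rfl fun k hk => ?_).trans (sum_subset htu fun k hk hkt => ?_)
    · simp [d', hts k hk]
    · have : k ∉ s := fun h => hkt (hut k hk h)
      simp [d', this]
  rw [hsum {k ∈ s | 0 ≤ k} (Icc (0 : ℤ) M), hsum s (Icc (-(M : ℤ)) M)]
  · exact hA d' M
  · exact fun k hk => mem_Icc.2 (hM k hk)
  · exact fun k hk => hk
  · exact fun k _ hk => hk
  · intro k hk
    rw [mem_filter] at hk
    exact mem_Icc.2 ⟨hk.2, (hM k hk.1).2⟩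
  · exact fun k hk => (mem_filter.1 hk).1
  · exact fun k hk hks => mem_filter.2 ⟨hks, (mem_Icc.1 hk).1⟩

theorem norm_trigSum_map_add (s : Finset ℤ) (d : ℤ → ℂ) (m : ℤ) (θ : ℝ) :
    ‖trigSum (s.map (addRightEmbedding m)) (fun k => d (k - m)) θ‖ = ‖trigSum s d θ‖ := by
  have : trigSum (s.map (addRightEmbedding m)) (fun k => d (k - m)) θ =
      trigSum s d θ * Complex.exp (((m * θ : ℝ) : ℂ) * Complex.I) := by
    unfold trigSum
    rw [sum_map, sum_mul]
    refine sum_congr rfl fun k _ => ?_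
    simp only [addRightEmbedding_apply, add_sub_cancel_right]
    rw [mul_assoc, ← Complex.exp_add]
    congr 2
    push_cast
    ring
  rw [this, norm_mul, Complex.norm_exp_ofReal_mul_I, mul_one]

/-- Uniform boundedness of partial sums on trigonometric polynomials (M. Riesz). -/
theorem exists_eLpNorm_trigSum_filter_abs_le {p : ℝ} (hp : 1 < p) :
    ∃ A : NNReal, ∀ (s : Finset ℤ) (d : ℤ → ℂ) (n : ℕ),
      eLpNorm (trigSum {k ∈ s | |k| ≤ n} d) (ENNReal.ofReal p) periodMeasure ≤
        A * eLpNorm (trigSum s d) (ENNReal.ofReal p) periodMeasure := by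
  obtain ⟨A, hA⟩ := exists_eLpNorm_trigSum_filter_nonneg_le hp
  have hp1 : (1 : ENNReal) ≤ ENNReal.ofReal p := by
    rw [← ENNReal.ofReal_one]; exact ENNReal.ofReal_le_ofReal hp.le
  have hshift : ∀ (s : Finset ℤ) (d : ℤ → ℂ) (m : ℤ),
      eLpNorm (trigSum {k ∈ s | m ≤ k} d) (ENNReal.ofReal p) periodMeasure ≤
        A * eLpNorm (trigSum s d) (ENNReal.ofReal p) periodMeasure := by
    intro s d m
    have h := hA (s.map (addRightEmbedding (-m))) (fun k => d (k - -m))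
    have hf : ({k ∈ s.map (addRightEmbedding (-m)) | 0 ≤ k}) =
        ({k ∈ s | m ≤ k}).map (addRightEmbedding (-m)) := by
      rw [filter_map]
      congr 1
      refine filter_congr fun k _ => ?_
      simp only [Function.comp, addRightEmbedding_apply]
      omega
    rw [hf, eLpNorm_congr_norm_ae (.of_forall (norm_trigSum_map_add _ d (-m))),
      eLpNorm_congr_norm_ae (.of_forall (norm_trigSum_map_add _ d (-m)))] at h
    exact h
  refine ⟨A + A, fun s d n => ?_⟩
  have heq : trigSum {k ∈ s | |k| ≤ n} d =
      trigSum {k ∈ s | -(n : ℤ) ≤ k} d - trigSum {k ∈ s | (n : ℤ) + 1 ≤ k} d := by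
    ext θ
    simp only [Pi.sub_apply, trigSum, sum_filter, ← sum_sub_distrib, abs_le]
    refine sum_congr rfl fun k _ => ?_
    by_cases h1 : -(n : ℤ) ≤ k <;> by_cases h2 : k ≤ (n : ℤ)
    · simp [h1, h2, show ¬ ((n : ℤ) + 1 ≤ k) by omega]
    · simp [h1, h2, show ((n : ℤ) + 1 ≤ k) by omega]
    · simp [h1, show ¬ ((n : ℤ) + 1 ≤ k) by omega]
    · omega
  rw [heq]
  refine (eLpNorm_sub_le (continuous_trigSum _ _).aestronglyMeasurable
    (continuous_trigSum _ _).aestronglyMeasurable hp1).trans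
    ((add_le_add (hshift s d _) (hshift s d _)).trans (le_of_eq ?_))
  push_cast
  ring

theorem continuous_dirichletKernel (n : ℕ) : Continuous (dirichletKernel n) := by
  unfold dirichletKernel
  fun_prop

theorem dirichletKernel_eq_sum_range (n : ℕ) (u : ℝ) :
    dirichletKernel n u = 1 / 2 + ∑ k ∈ range n, Real.cos ((k + 1 : ℕ) * u) := by
  rw [dirichletKernel, range_eq_Ico, sum_Ico_add' (fun k : ℕ => Real.cos (k * u)) 0 n 1]
  rfl

theorem dirichletKernel_succ (n : ℕ) (u : ℝ) :
    dirichletKernel (n + 1) u = dirichletKernel n u + Real.cos ((n + 1 : ℕ) * u) := by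
  rw [dirichletKernel_eq_sum_range, dirichletKernel_eq_sum_range, sum_range_succ, add_assoc]

theorem ofReal_dirichletKernel (n : ℕ) (u : ℝ) :
    (dirichletKernel n u : ℂ) =
      1 / 2 * ∑ k ∈ Icc (-(n : ℤ)) n, Complex.exp (k * (u * Complex.I)) := by
  rw [dirichletKernel_eq_sum_range, sum_Icc_neg_natCast, mul_add, mul_sum]
  push_cast
  simp only [zero_mul, Complex.exp_zero, mul_one]
  congr 1
  refine sum_congr rfl fun k _ => ?_
  rw [Complex.cos]
  have e1 : ((k : ℂ) + 1) * u * Complex.I = (k + 1) * (u * Complex.I) := by ring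
  have e2 : -(((k : ℂ) + 1) * u) * Complex.I = (-1 + -k) * (u * Complex.I) := by ring
  rw [e1, e2]
  ring_nf

theorem dirichletKernel_periodic (n : ℕ) : Function.Periodic (dirichletKernel n) (2 * π) := by
  intro u
  unfold dirichletKernel
  congr 1
  refine sum_congr rfl fun k _ => ?_
  rw [mul_add, Real.cos_add_nat_mul_two_pi]

theorem integral_dirichletKernel (n : ℕ) : ∫ u in (-π)..π, dirichletKernel n u = π := by
  induction n with
  | zero => simp [dirichletKernel]; ring
  | succ n ih =>
    simp only [dirichletKernel_succ]
    rw [intervalIntegral.integral_add ((continuous_dirichletKernel n).intervalIntegrable _ _)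
      ((by fun_prop : Continuous _).intervalIntegrable _ _), ih,
      intervalIntegral.integral_comp_mul_left (fun x => Real.cos x)
        (by positivity : ((n + 1 : ℕ) : ℝ) ≠ 0), integral_cos, mul_neg, Real.sin_neg,
      Real.sin_nat_mul_pi]
    simp

theorem one_sub_cos_mul_dirichletKernel (n : ℕ) (u : ℝ) :
    2 * (1 - Real.cos u) * dirichletKernel n u =
      Real.cos (n * u) - Real.cos ((n + 1 : ℕ) * u) := by
  induction n with
  | zero => simp [dirichletKernel]; ring
  | succ n ih =>
    rw [dirichletKernel_succ, mul_add, ih]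
    have h1 : Real.cos ((n + 1 + 1 : ℕ) * u) = Real.cos ((n + 1 : ℕ) * u + u) := by
      congr 1; push_cast; ring
    have h2 : Real.cos (n * u) = Real.cos ((n + 1 : ℕ) * u - u) := by
      congr 1; push_cast; ring
    rw [h1, h2, Real.cos_add, Real.cos_sub]
    ring

/-- The Fejér kernel. -/
noncomputable def fejerKernel (N : ℕ) (u : ℝ) : ℝ :=
  1 / N * ∑ k ∈ range N, dirichletKernel k u

theorem continuous_fejerKernel (N : ℕ) : Continuous (fejerKernel N) := by
  unfold fejerKernel
  exact continuous_const.mul (continuous_finsetSum _ fun k _ => continuous_dirichletKernel k)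

theorem integral_fejerKernel {N : ℕ} (hN : 1 ≤ N) : ∫ u in (-π)..π, fejerKernel N u = π := by
  unfold fejerKernel
  rw [intervalIntegral.integral_const_mul, intervalIntegral.integral_finsetSum
    fun k _ => (continuous_dirichletKernel k).intervalIntegrable _ _]
  simp only [integral_dirichletKernel, sum_const, card_range, nsmul_eq_mul]
  have : (N : ℝ) ≠ 0 := by positivity
  field_simp

theorem abs_fejerKernel_le (N : ℕ) (u : ℝ) : |fejerKernel N u| ≤ N := by
  have hD : ∀ k, |dirichletKernel k u| ≤ (k : ℝ) + 1 := by
    intro k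
    induction k with
    | zero => norm_num [dirichletKernel, abs_of_pos]
    | succ k ih =>
      rw [dirichletKernel_succ]
      push_cast
      exact (abs_add_le _ _).trans (add_le_add ih (Real.abs_cos_le_one _))
  rcases Nat.eq_zero_or_pos N with rfl | hN
  · simp [fejerKernel]
  have hN' : (0 : ℝ) < N := by exact_mod_cast hN
  have hsum : |∑ k ∈ range N, dirichletKernel k u| ≤ N * N := by
    refine (abs_sum_le_sum_abs _ _).trans ?_
    refine (sum_le_sum (g := fun _ => (N : ℝ)) fun k hk => (hD k).trans ?_).trans (by simp)
    exact_mod_cast mem_range.1 hk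
  rw [fejerKernel, abs_mul, abs_of_pos (by positivity : (0 : ℝ) < 1 / N), one_div,
    inv_mul_le_iff₀ hN']
  exact hsum

theorem abs_fejerKernel_le_div {N : ℕ} (hN : 1 ≤ N) {u : ℝ} (hu : |u| ≤ π) (hu0 : u ≠ 0) :
    |fejerKernel N u| ≤ π ^ 2 / (2 * N) * (u ^ 2)⁻¹ := by
  have hN' : (0 : ℝ) < N := by exact_mod_cast hN
  have hu2 : 0 < u ^ 2 := by positivity
  have htel : 2 * (1 - Real.cos u) * ∑ k ∈ range N, dirichletKernel k u =
      1 - Real.cos (N * u) := by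
    rw [mul_sum, sum_congr rfl fun k _ => one_sub_cos_mul_dirichletKernel k u,
      sum_range_sub' fun k : ℕ => Real.cos (k * u)]
    simp
  have hcos : 2 / π ^ 2 * u ^ 2 ≤ 1 - Real.cos u := by
    linarith [Real.cos_le_one_sub_mul_cos_sq hu]
  have hcpos : 0 < 1 - Real.cos u := lt_of_lt_of_le (by positivity) hcos
  have hS : |∑ k ∈ range N, dirichletKernel k u| * (1 - Real.cos u) ≤ 1 := by
    have h := congrArg abs htel
    rw [abs_mul, abs_of_pos (by linarith : 0 < 2 * (1 - Real.cos u))] at h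
    have h2 : |1 - Real.cos (N * u)| ≤ 2 := by
      rw [abs_le]; constructor <;> linarith [Real.cos_le_one (N * u), Real.neg_one_le_cos (N * u)]
    linarith
  have hS2 : |∑ k ∈ range N, dirichletKernel k u| * (2 / π ^ 2 * u ^ 2) ≤ 1 :=
    (mul_le_mul_of_nonneg_left hcos (abs_nonneg _)).trans hS
  have hπ := Real.pi_pos
  rw [fejerKernel, abs_mul, abs_of_pos (by positivity : (0 : ℝ) < 1 / N)]
  calc 1 / (N : ℝ) * |∑ k ∈ range N, dirichletKernel k u|
      = π ^ 2 / (2 * N) * (u ^ 2)⁻¹ *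
          (|∑ k ∈ range N, dirichletKernel k u| * (2 / π ^ 2 * u ^ 2)) := by
        field_simp
    _ ≤ π ^ 2 / (2 * N) * (u ^ 2)⁻¹ * 1 := by gcongr
    _ = _ := mul_one _

theorem fejerKernel_neg (N : ℕ) (u : ℝ) : fejerKernel N (-u) = fejerKernel N u := by
  simp [fejerKernel, dirichletKernel]

theorem exists_integral_abs_fejerKernel_mul_rpow_le {α : ℝ} (hα0 : 0 < α) (hα1 : α < 1) :
    ∃ C : ℝ, 0 ≤ C ∧ ∀ N : ℕ, 1 ≤ N →
      ∫ u in (-π)..π, |fejerKernel N u| * |u| ^ α ≤ C * (N : ℝ) ^ (-α) := by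
  have hπ := Real.pi_pos
  have hα1' : 0 < 1 - α := by linarith
  refine ⟨2 * (1 + π ^ 2 / (2 * (1 - α))), by positivity, fun N hN => ?_⟩
  have hN' : (0 : ℝ) < N := by exact_mod_cast hN
  have hN1 : (1 : ℝ) ≤ N := by exact_mod_cast hN
  have hNπ : 1 / (N : ℝ) ≤ π :=
    ((div_le_one hN').2 hN1).trans (by linarith [Real.pi_gt_three])
  set g : ℝ → ℝ := fun u => |fejerKernel N u| * |u| ^ α with hg
  have hgc : Continuous g := (continuous_fejerKernel N).abs.mul
    (continuous_abs.rpow_const fun _ => Or.inr hα0.le)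
  have hint : ∀ a b, IntervalIntegrable g volume a b := fun a b => hgc.intervalIntegrable a b
  have heven : ∫ u in (-π)..0, g u = ∫ u in (0 : ℝ)..π, g u := by
    have h := intervalIntegral.integral_comp_neg (a := 0) (b := π) g
    rw [neg_zero] at h
    rw [← h]
    refine intervalIntegral.integral_congr fun u _ => ?_
    simp [hg, fejerKernel_neg]
  have hnear : ∫ u in (0 : ℝ)..(1 / N), g u ≤ (N : ℝ) ^ (-α) := by
    have h := intervalIntegral.integral_mono_on (by positivity : (0 : ℝ) ≤ 1 / N) (hint _ _)
      (intervalIntegrable_const (c := (N : ℝ) * (1 / N) ^ α)) (fun u hu => by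
        rw [hg]
        dsimp only
        rw [abs_of_nonneg hu.1]
        exact mul_le_mul (abs_fejerKernel_le N u) (rpow_le_rpow hu.1 hu.2 hα0.le)
          (rpow_nonneg hu.1 _) hN'.le)
    rw [intervalIntegral.integral_const, smul_eq_mul, sub_zero] at h
    refine h.trans (le_of_eq ?_)
    rw [one_div, inv_rpow hN'.le, ← rpow_neg hN'.le]
    field_simp
  have hfar : ∫ u in (1 / N : ℝ)..π, g u ≤ π ^ 2 / (2 * (1 - α)) * (N : ℝ) ^ (-α) := by
    have hnot : (0 : ℝ) ∉ Set.uIcc (1 / (N : ℝ)) π := by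
      rw [Set.uIcc_of_le hNπ]
      exact fun h => absurd h.1 (not_le.2 (by positivity))
    have h := intervalIntegral.integral_mono_on hNπ (hint _ _)
      ((intervalIntegral.intervalIntegrable_rpow (r := α - 2) (Or.inr hnot)).const_mul
        (π ^ 2 / (2 * N))) (fun u hu => by
        have hu0 : 0 < u := lt_of_lt_of_le (by positivity) hu.1
        rw [hg]
        dsimp only
        rw [abs_of_pos hu0, rpow_sub hu0, rpow_two]
        calc |fejerKernel N u| * u ^ α ≤ π ^ 2 / (2 * N) * (u ^ 2)⁻¹ * u ^ α := by
              gcongr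
              exact abs_fejerKernel_le_div hN (by rw [abs_of_pos hu0]; exact hu.2) hu0.ne'
          _ = _ := by rw [div_eq_mul_inv (u ^ α)]; ring)
    rw [intervalIntegral.integral_const_mul, integral_rpow (Or.inr ⟨by linarith, hnot⟩)] at h
    refine h.trans ?_
    have e : (1 / (N : ℝ)) ^ (α - 2 + 1) = N * (N : ℝ) ^ (-α) := by
      rw [one_div, inv_rpow hN'.le, ← rpow_neg hN'.le, ← rpow_one_add' hN'.le (by linarith)]
      congr 1; ring
    have e2 : α - 2 + 1 = -(1 - α) := by ring
    rw [e, e2]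
    have h3 : 0 ≤ π ^ (-(1 - α)) := by positivity
    calc π ^ 2 / (2 * N) * ((π ^ (-(1 - α)) - N * (N : ℝ) ^ (-α)) / -(1 - α))
        = π ^ 2 / (2 * N) * ((N * (N : ℝ) ^ (-α) - π ^ (-(1 - α))) / (1 - α)) := by
          rw [div_neg, ← neg_div, neg_sub]
      _ ≤ π ^ 2 / (2 * N) * ((N * (N : ℝ) ^ (-α)) / (1 - α)) := by gcongr; linarith
      _ = _ := by field_simp
  rw [← intervalIntegral.integral_add_adjacent_intervals (hint _ 0) (hint _ _), heven,
    ← intervalIntegral.integral_add_adjacent_intervals (hint _ (1 / N)) (hint _ _)]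
  linarith

theorem exists_lintegral_fejerKernel_le {α : ℝ} (hα0 : 0 < α) (hα1 : α < 1) :
    ∃ C : ℝ, 0 ≤ C ∧ ∀ N : ℕ, 1 ≤ N →
      ∫⁻ u in Set.Ioc (-π) π, ‖fejerKernel N u‖ₑ * ENNReal.ofReal (|u| ^ α) ≤
        ENNReal.ofReal (C * (N : ℝ) ^ (-α)) := by
  obtain ⟨C, hC0, hC⟩ := exists_integral_abs_fejerKernel_mul_rpow_le hα0 hα1
  refine ⟨C, hC0, fun N hN => ?_⟩
  have hgc : Continuous fun u => |fejerKernel N u| * |u| ^ α :=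
    (continuous_fejerKernel N).abs.mul (continuous_abs.rpow_const fun _ => Or.inr hα0.le)
  refine le_trans (le_of_eq ?_) (ENNReal.ofReal_le_ofReal (hC N hN))
  rw [intervalIntegral.integral_of_le (by linarith [Real.pi_pos]),
    ofReal_integral_eq_lintegral_ofReal]
  · refine lintegral_congr fun u => ?_
    rw [ENNReal.ofReal_mul (abs_nonneg _), ← Real.enorm_eq_ofReal_abs]
  · exact (hgc.intervalIntegrable (-π) π).1
  · exact Filter.Eventually.of_forall fun u => by positivity

/-- A form of Minkowski's integral inequality. -/
theorem lintegral_rpow_lintegral_mul_le {X Y : Type*} [MeasurableSpace X] [MeasurableSpace Y]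
    {μ : Measure X} {ν : Measure Y} [SFinite μ] [SFinite ν] {p : ℝ} (hp : 1 < p)
    {k : Y → ENNReal} (hk : AEMeasurable k ν) {G : X → Y → ENNReal}
    (hG : AEMeasurable (Function.uncurry G) (μ.prod ν))
    (hG1 : ∀ᵐ u ∂ν, ∫⁻ x, G x u ^ p ∂μ ≤ 1) :
    ∫⁻ x, (∫⁻ u, k u * G x u ∂ν) ^ p ∂μ ≤ (∫⁻ u, k u ∂ν) ^ p := by
  have hp0 : 0 < p := by linarith
  have hpq := Real.HolderConjugate.conjExponent hp
  set q := p.conjExponent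
  have hq0 : 0 < q := hpq.symm.pos
  have hsec : ∀ᵐ x ∂μ, AEMeasurable (G x) ν :=
    hG.aestronglyMeasurable.prodMk_left.mono fun _ h => h.aemeasurable
  have hholder : ∀ᵐ x ∂μ, (∫⁻ u, k u * G x u ∂ν) ^ p ≤
      (∫⁻ u, k u ∂ν) ^ (p - 1) * ∫⁻ u, k u * G x u ^ p ∂ν := by
    filter_upwards [hsec] with x hx
    have h := ENNReal.lintegral_mul_le_Lp_mul_Lq ν hpq.symm
      (f := fun u => k u ^ (1 / q)) (g := fun u => k u ^ (1 / p) * G x u)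
      (hk.pow_const _) ((hk.pow_const _).mul hx)
    have e1 : ∀ u, ((fun u => k u ^ (1 / q)) * fun u => k u ^ (1 / p) * G x u) u =
        k u * G x u := by
      intro u
      simp only [Pi.mul_apply]
      rw [← mul_assoc, ← ENNReal.rpow_add_of_nonneg _ _ (by positivity) (by positivity),
        one_div, one_div, hpq.symm.inv_add_inv_eq_one, ENNReal.rpow_one]
    have e2 : ∀ u, (k u ^ (1 / q)) ^ q = k u := fun u => by
      rw [← ENNReal.rpow_mul, one_div_mul_cancel hq0.ne', ENNReal.rpow_one]
    have e3 : ∀ u, (k u ^ (1 / p) * G x u) ^ p = k u * G x u ^ p := fun u => by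
      rw [ENNReal.mul_rpow_of_nonneg _ _ hp0.le, ← ENNReal.rpow_mul, one_div_mul_cancel hp0.ne',
        ENNReal.rpow_one]
    simp only [e1, e2, e3] at h
    refine (ENNReal.rpow_le_rpow h hp0.le).trans (le_of_eq ?_)
    rw [ENNReal.mul_rpow_of_nonneg _ _ hp0.le, ← ENNReal.rpow_mul, ← ENNReal.rpow_mul,
      one_div_mul_cancel hp0.ne', ENNReal.rpow_one]
    congr 2
    have := hpq.sub_one_mul_conj
    field_simp
    linarith
  have hmeas : AEMeasurable (Function.uncurry fun x u => k u * G x u ^ p) (μ.prod ν) :=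
    (hk.comp_snd).mul (hG.pow_const p)
  calc ∫⁻ x, (∫⁻ u, k u * G x u ∂ν) ^ p ∂μ
      ≤ ∫⁻ x, (∫⁻ u, k u ∂ν) ^ (p - 1) * ∫⁻ u, k u * G x u ^ p ∂ν ∂μ := lintegral_mono_ae hholder
    _ = (∫⁻ u, k u ∂ν) ^ (p - 1) * ∫⁻ x, ∫⁻ u, k u * G x u ^ p ∂ν ∂μ :=
        lintegral_const_mul'' _ hmeas.lintegral_prod_right'
    _ = (∫⁻ u, k u ∂ν) ^ (p - 1) * ∫⁻ u, ∫⁻ x, k u * G x u ^ p ∂μ ∂ν := by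
        rw [lintegral_lintegral_swap hmeas]
    _ ≤ (∫⁻ u, k u ∂ν) ^ (p - 1) * ∫⁻ u, k u ∂ν := by
        gcongr 1
        refine lintegral_mono_ae ?_
        have hsec2 : ∀ᵐ u ∂ν, AEMeasurable (fun x => G x u) μ :=
          hG.prod_swap.aestronglyMeasurable.prodMk_left.mono fun _ h => h.aemeasurable
        filter_upwards [hG1, hsec2] with u hu hm
        rw [lintegral_const_mul'' _ (hm.pow_const p)]
        exact (mul_le_mul_right hu _).trans_eq (mul_one _)
    _ = _ := by
        conv_lhs => rw [← ENNReal.rpow_one (∫⁻ u, k u ∂ν), ← ENNReal.rpow_mul]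
        rw [one_mul, ← ENNReal.rpow_add_of_nonneg _ _ (by linarith) zero_le_one,
          sub_add_cancel]

theorem lpNorm_eq_eLpNorm {p : ℝ} (hp : 0 < p) {g : ℝ → ℝ}
    (hg : MemLp g (ENNReal.ofReal p) periodMeasure) :
    _root_.lpNorm p g =
      (1 / (2 * π)) ^ (1 / p) * (eLpNorm g (ENNReal.ofReal p) periodMeasure).toReal := by
  have hI : 0 ≤ ∫ θ in (0 : ℝ)..2 * π, |g θ| ^ p :=
    intervalIntegral.integral_nonneg (by positivity) fun θ _ => by positivity
  rw [eLpNorm_periodMeasure_eq hp hg, ENNReal.toReal_ofReal (rpow_nonneg (by simpa using hI) _),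
    _root_.lpNorm, mul_rpow (by positivity) hI]
  rfl

theorem aestronglyMeasurable_of_periodic {f : ℝ → ℝ} (hper : Function.Periodic f (2 * π))
    (hint : IntervalIntegrable f volume 0 (2 * π)) : AEStronglyMeasurable f volume := by
  refine LocallyIntegrable.aestronglyMeasurable (locallyIntegrable_iff.2 fun k hk => ?_)
  obtain ⟨a, ha⟩ := hk.bddBelow
  obtain ⟨b, hb⟩ := hk.bddAbove
  have h := hper.intervalIntegrable₀ (by positivity) hint (a - 1) (max a b)
  rw [intervalIntegrable_iff_integrableOn_Ioc_of_le
    (by linarith [le_max_left a b])] at h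
  exact h.mono_set fun x hx => ⟨by linarith [ha hx], (hb hx).trans (le_max_right _ _)⟩

theorem LipClass.aestronglyMeasurable {α p : ℝ} {f : ℝ → ℝ} (hf : LipClass α p f) :
    AEStronglyMeasurable f volume :=
  aestronglyMeasurable_of_periodic hf.1 hf.2.1

theorem LipClass.memLp_comp_add {α p : ℝ} (hp : 0 < p) {f : ℝ → ℝ} (hf : LipClass α p f) (h : ℝ) :
    MemLp (fun x => f (x + h)) (ENNReal.ofReal p) periodMeasure := by
  have hm : AEStronglyMeasurable (fun x => f (x + h)) volume :=
    hf.aestronglyMeasurable.comp_measurePreserving (measurePreserving_add_right volume h)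
  refine (integrable_norm_rpow_iff hm.restrict (by simpa using hp) ENNReal.ofReal_ne_top).1 ?_
  rw [ENNReal.toReal_ofReal hp.le]
  have hper : Function.Periodic (fun x => |f x| ^ p) (2 * π) := fun x => by simp only [hf.1 x]
  have := (hper.intervalIntegrable₀ (by positivity) hf.2.2.1 (0 + h) (2 * π + h)).comp_add_right h
  simp only [add_sub_cancel_right] at this
  exact this.1

theorem LipClass.memLp {α p : ℝ} (hp : 0 < p) {f : ℝ → ℝ} (hf : LipClass α p f) :
    MemLp f (ENNReal.ofReal p) periodMeasure := by
  simpa using hf.memLp_comp_add hp 0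

theorem LipClass.eLpNorm_comp_add {α p : ℝ} (hp : 0 < p) {f : ℝ → ℝ} (hf : LipClass α p f)
    (h : ℝ) : eLpNorm (fun x => f (x + h)) (ENNReal.ofReal p) periodMeasure =
      eLpNorm f (ENNReal.ofReal p) periodMeasure := by
  rw [eLpNorm_periodMeasure_eq hp (hf.memLp_comp_add hp h),
    eLpNorm_periodMeasure_eq hp (hf.memLp hp),
    intervalIntegral.integral_comp_add_right (fun x => ‖f x‖ ^ p)]
  have hper : Function.Periodic (fun x => ‖f x‖ ^ p) (2 * π) := fun x => by simp only [hf.1 x]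
  have := hper.intervalIntegral_add_eq h 0
  rw [zero_add] at this
  rw [zero_add, add_comm (2 * π), this]

theorem LipClass.exists_eLpNorm_sub_le {α p : ℝ} (hp : 1 < p) {f : ℝ → ℝ}
    (hf : LipClass α p f) : ∃ C : ℝ, 0 < C ∧ ∀ h : ℝ, h ≠ 0 →
      eLpNorm (fun x => f (x + h) - f x) (ENNReal.ofReal p) periodMeasure ≤
        ENNReal.ofReal (C * |h| ^ α) := by
  have hp0 : 0 < p := by linarith
  have hq : 1 ≤ ENNReal.ofReal p := by simpa using hp.le
  obtain ⟨C, hC0, hC⟩ := hf.2.2.2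
  have hc : 0 < (1 / (2 * π)) ^ (1 / p) := by positivity
  set c := (1 / (2 * π)) ^ (1 / p) with hcdef
  have hmem : ∀ h : ℝ, MemLp (fun x => f (x + h) - f x) (ENNReal.ofReal p) periodMeasure :=
    fun h => (hf.memLp_comp_add hp0 h).sub (hf.memLp hp0)
  have hbound : ∀ h : ℝ, _root_.lpNorm p (fun x => f (x + h) - f x) ≤
      c * (eLpNorm f (ENNReal.ofReal p) periodMeasure +
        eLpNorm f (ENNReal.ofReal p) periodMeasure).toReal := fun h => by
    rw [lpNorm_eq_eLpNorm hp0 (hmem h)]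
    refine mul_le_mul_of_nonneg_left (ENNReal.toReal_mono ?_ ?_) hc.le
    · exact ENNReal.add_ne_top.2 ⟨(hf.memLp hp0).2.ne, (hf.memLp hp0).2.ne⟩
    · exact (eLpNorm_sub_le (hf.memLp_comp_add hp0 h).1 (hf.memLp hp0).1 hq).trans_eq
        (by rw [hf.eLpNorm_comp_add hp0])
  refine ⟨C / c, by positivity, fun h hh => ?_⟩
  have hle : _root_.lpNorm p (fun x => f (x + h) - f x) ≤ C * |h| ^ α := by
    refine le_trans (le_csSup ?_ ?_) (hC |h| (abs_pos.2 hh))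
    · exact ⟨_, by rintro _ ⟨h, _, _, rfl⟩; exact hbound h⟩
    · exact ⟨h, abs_pos.2 hh, le_rfl, rfl⟩
  rw [lpNorm_eq_eLpNorm hp0 (hmem h), ← hcdef] at hle
  rw [← ENNReal.ofReal_toReal (hmem h).2.ne]
  refine ENNReal.ofReal_le_ofReal ?_
  rw [div_mul_eq_mul_div, le_div_iff₀ hc]
  linarith

/-- The Fejér means of the Fourier series of `f`. -/
noncomputable def fejerMean (f : ℝ → ℝ) (N : ℕ) (x : ℝ) : ℝ :=
  1 / N * ∑ k ∈ range N, partialFourierSum f k x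

theorem fejerKernel_periodic (N : ℕ) : Function.Periodic (fejerKernel N) (2 * π) := by
  intro u
  simp only [fejerKernel, dirichletKernel_periodic _ u]

theorem fejerMean_eq_integral {f : ℝ → ℝ} (hper : Function.Periodic f (2 * π))
    (hint : IntervalIntegrable f volume 0 (2 * π)) (N : ℕ) (x : ℝ) :
    fejerMean f N x = 1 / π * ∫ u in (-π)..π, fejerKernel N u * f (x - u) := by
  have h1 : fejerMean f N x =
      1 / π * ∫ t in (0 : ℝ)..(2 * π), fejerKernel N (x - t) * f (x - (x - t)) := by
    simp only [fejerMean, partialFourierSum, fejerKernel]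
    rw [← mul_sum, ← intervalIntegral.integral_finsetSum, mul_left_comm,
      ← intervalIntegral.integral_const_mul]
    · congr 1
      refine intervalIntegral.integral_congr fun t _ => ?_
      simp only [sub_sub_cancel]
      rw [← mul_sum]
      ring
    · exact fun k _ => hint.mul_continuousOn
        ((continuous_dirichletKernel k).comp (by fun_prop)).continuousOn
  have hp : Function.Periodic (fun u => fejerKernel N u * f (x - u)) (2 * π) := fun u => by
    simp only [fejerKernel_periodic N u, ← sub_sub, hper.sub_eq]
  rw [h1, intervalIntegral.integral_comp_sub_left (fun u => fejerKernel N u * f (x - u))]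
  have := hp.intervalIntegral_add_eq (x - 2 * π) (-π)
  rw [sub_add_cancel, show -π + 2 * π = π by ring] at this
  rw [sub_zero, this]

theorem fejerMean_sub_eq_integral {f : ℝ → ℝ} (hper : Function.Periodic f (2 * π))
    (hint : IntervalIntegrable f volume 0 (2 * π)) {N : ℕ} (hN : 1 ≤ N) (x : ℝ) :
    fejerMean f N x - f x = 1 / π * ∫ u in (-π)..π, fejerKernel N u * (f (x - u) - f x) := by
  have hcont := continuous_fejerKernel N
  have hfi : IntervalIntegrable (fun u => f (x - u)) volume (-π) π := by
    simpa using (hper.intervalIntegrable₀ (by positivity) hint (x - -π) (x - π)).comp_sub_left x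
  simp only [mul_sub]
  rw [intervalIntegral.integral_sub (hfi.continuousOn_mul hcont.continuousOn)
    ((by fun_prop : Continuous fun u => fejerKernel N u * f x).intervalIntegrable _ _), intervalIntegral.integral_mul_const,
    integral_fejerKernel hN, mul_sub, ← fejerMean_eq_integral hper hint]
  field_simp

theorem LipClass.exists_eLpNorm_fejerMean_sub_le {α p : ℝ} (hp : 1 < p) (hα0 : 0 < α)
    (hα1 : α < 1) {f : ℝ → ℝ} (hf : LipClass α p f) :
    ∃ C : ℝ, 0 ≤ C ∧ ∀ N : ℕ, 1 ≤ N →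
      eLpNorm (fun x => fejerMean f N x - f x) (ENNReal.ofReal p) periodMeasure ≤
        ENNReal.ofReal (C * (N : ℝ) ^ (-α)) := by
  have hp0 : 0 < p := by linarith
  have hq0 : ENNReal.ofReal p ≠ 0 := by simpa using hp0
  obtain ⟨B, hB0, hB⟩ := hf.exists_eLpNorm_sub_le hp
  obtain ⟨C, hC0, hC⟩ := exists_lintegral_fejerKernel_le hα0 hα1
  refine ⟨B * C, by positivity, fun N hN => ?_⟩
  set ν : Measure ℝ := volume.restrict (Set.Ioc (-π) π)
  have hne : ∀ᵐ u ∂ν, u ≠ 0 := ae_restrict_of_ae (Measure.ae_ne volume 0)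
  let b : ℝ → ENNReal := fun u => ENNReal.ofReal (B * |u| ^ α)
  have hb0 : ∀ u, u ≠ 0 → b u ≠ 0 := fun u hu => by
    have := abs_pos.2 hu
    simp only [b, ne_eq, ENNReal.ofReal_eq_zero, not_le]
    positivity
  have hbt : ∀ u, b u ≠ ⊤ := fun u => ENNReal.ofReal_ne_top
  have hbm : Measurable b := by fun_prop
  let k : ℝ → ENNReal := fun u => ‖fejerKernel N u‖ₑ * b u
  have hkm : Measurable k := (continuous_fejerKernel N).measurable.enorm.mul hbm
  let G : ℝ → ℝ → ENNReal := fun x u => ‖f (x - u) - f x‖ₑ / b u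
  have hfm := hf.aestronglyMeasurable
  have hGm : AEMeasurable (Function.uncurry G) (periodMeasure.prod ν) := by
    have hsub : AEStronglyMeasurable (fun z : ℝ × ℝ => f (z.1 - z.2) - f z.1)
        (volume.prod volume) :=
      (hfm.comp_quasiMeasurePreserving (quasiMeasurePreserving_sub volume volume)).sub
        (hfm.comp_quasiMeasurePreserving Measure.quasiMeasurePreserving_fst)
    rw [Measure.prod_restrict]
    exact hsub.restrict.enorm.div (hbm.comp measurable_snd).aemeasurable
  have hG1 : ∀ᵐ u ∂ν, ∫⁻ x, G x u ^ p ∂periodMeasure ≤ 1 := by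
    filter_upwards [hne] with u hu
    have h := hB (-u) (neg_ne_zero.2 hu)
    simp only [← sub_eq_add_neg, abs_neg] at h
    rw [eLpNorm_eq_lintegral_rpow_enorm_toReal hq0 ENNReal.ofReal_ne_top,
      ENNReal.toReal_ofReal hp0.le, one_div, ENNReal.rpow_inv_le_iff hp0] at h
    simp only [G, div_eq_mul_inv]
    simp only [ENNReal.mul_rpow_of_nonneg _ _ hp0.le]
    rw [lintegral_mul_const' _ _ (by
      simp [ENNReal.rpow_eq_top_iff, hb0 u hu, hbt u]), ENNReal.inv_rpow, ← div_eq_mul_inv]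
    exact ENNReal.div_le_of_le_mul (by rw [one_mul]; exact h)
  have hpoint : ∀ x, ‖fejerMean f N x - f x‖ₑ ≤ ∫⁻ u, k u * G x u ∂ν := fun x => by
    rw [fejerMean_sub_eq_integral hf.1 hf.2.1 hN, enorm_mul,
      intervalIntegral.integral_of_le (by linarith [Real.pi_pos])]
    have h1 : ‖1 / π‖ₑ ≤ 1 := by
      rw [Real.enorm_eq_ofReal (by positivity), ENNReal.ofReal_le_one,
        div_le_one Real.pi_pos]
      linarith [Real.pi_gt_three]
    refine (mul_le_of_le_one_left zero_le h1).trans ((enorm_integral_le_lintegral_enorm _).trans ?_)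
    refine lintegral_mono_ae ?_
    filter_upwards [hne] with u hu
    simp only [k, G]
    rw [enorm_mul, mul_assoc, ENNReal.mul_div_cancel (hb0 u hu) (hbt u)]
  have hk : ∫⁻ u, k u ∂ν ≤ ENNReal.ofReal (B * C * (N : ℝ) ^ (-α)) := by
    have : ∀ u, k u = ENNReal.ofReal B * (‖fejerKernel N u‖ₑ * ENNReal.ofReal (|u| ^ α)) :=
      fun u => by simp only [k, b]; rw [ENNReal.ofReal_mul hB0.le]; ring
    simp only [this]
    rw [lintegral_const_mul' _ _ ENNReal.ofReal_ne_top, mul_assoc, ENNReal.ofReal_mul hB0.le]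
    exact mul_le_mul_right (hC N hN) _
  refine le_trans ?_ hk
  rw [eLpNorm_eq_lintegral_rpow_enorm_toReal hq0 ENNReal.ofReal_ne_top,
    ENNReal.toReal_ofReal hp0.le, one_div, ENNReal.rpow_inv_le_iff hp0]
  exact (lintegral_mono fun x => ENNReal.rpow_le_rpow (hpoint x) hp0.le).trans
    (lintegral_rpow_lintegral_mul_le hp hkm.aemeasurable hGm hG1)

/-- The complex Fourier coefficients of a function on `[0, 2π]`. -/
noncomputable def expCoeff (f : ℝ → ℝ) (k : ℤ) : ℂ :=
  1 / (2 * π) * ∫ t in (0 : ℝ)..(2 * π), (f t : ℂ) * Complex.exp (-(k * (t * Complex.I)))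

theorem ofReal_partialFourierSum {f : ℝ → ℝ} (hint : IntervalIntegrable f volume 0 (2 * π))
    (n : ℕ) (x : ℝ) :
    (partialFourierSum f n x : ℂ) = trigSum (Icc (-(n : ℤ)) n) (expCoeff f) x := by
  have hcint : IntervalIntegrable (fun t => (f t : ℂ)) volume 0 (2 * π) :=
    ⟨hint.1.ofReal, hint.2.ofReal⟩
  have hterm : ∀ t, ((f t * dirichletKernel n (x - t) : ℝ) : ℂ) =
      ∑ k ∈ Icc (-(n : ℤ)) n, 1 / 2 * Complex.exp (k * (x * Complex.I)) *
        ((f t : ℂ) * Complex.exp (-(k * (t * Complex.I)))) := fun t => by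
    rw [Complex.ofReal_mul, ofReal_dirichletKernel, mul_sum, mul_sum]
    refine sum_congr rfl fun k _ => ?_
    have : (k : ℂ) * (((x - t : ℝ) : ℂ) * Complex.I) =
        k * (x * Complex.I) + -(k * (t * Complex.I)) := by push_cast; ring
    rw [this, Complex.exp_add]
    ring
  rw [partialFourierSum, Complex.ofReal_mul, ← intervalIntegral.integral_ofReal]
  simp only [hterm]
  rw [intervalIntegral.integral_finsetSum, mul_sum, trigSum]
  · refine sum_congr rfl fun k _ => ?_
    rw [intervalIntegral.integral_const_mul, expCoeff]
    push_cast
    ring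
  · exact fun k _ => (hcint.mul_continuousOn
      (by fun_prop : Continuous fun t : ℝ =>
        Complex.exp (-(k * (t * Complex.I)))).continuousOn).const_mul _

theorem continuous_partialFourierSum {f : ℝ → ℝ} (hint : IntervalIntegrable f volume 0 (2 * π))
    (n : ℕ) : Continuous (partialFourierSum f n) := by
  have h : partialFourierSum f n =
      fun x => (trigSum (Icc (-(n : ℤ)) n) (expCoeff f) x).re := by
    funext x
    rw [← ofReal_partialFourierSum hint, Complex.ofReal_re]
  rw [h]
  exact Complex.continuous_re.comp (continuous_trigSum _ _)

theorem continuous_fejerMean {f : ℝ → ℝ} (hint : IntervalIntegrable f volume 0 (2 * π))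
    (N : ℕ) : Continuous (fejerMean f N) := by
  unfold fejerMean
  exact continuous_const.mul (continuous_finsetSum _ fun k _ => continuous_partialFourierSum hint k)

theorem filter_abs_le_Icc_neg {n M : ℕ} (h : n ≤ M) :
    ({k ∈ Icc (-(M : ℤ)) M | |k| ≤ n} : Finset ℤ) = Icc (-(n : ℤ)) n := by
  ext k
  simp only [mem_filter, mem_Icc, abs_le]
  omega

theorem ofReal_fejerMean {f : ℝ → ℝ} (hint : IntervalIntegrable f volume 0 (2 * π))
    {N M : ℕ} (hNM : N ≤ M + 1) (x : ℝ) :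
    (fejerMean f N x : ℂ) = trigSum (Icc (-(M : ℤ)) M)
      (fun j => 1 / N * (N - j.natAbs : ℕ) * expCoeff f j) x := by
  rw [fejerMean, trigSum, Complex.ofReal_mul, Complex.ofReal_sum]
  have h : ∀ k ∈ range N, (partialFourierSum f k x : ℂ) = ∑ j ∈ Icc (-(M : ℤ)) M,
      if |j| ≤ k then expCoeff f j * Complex.exp (j * (x * Complex.I)) else 0 := fun k hk => by
    have hk' : k ≤ M := by have := mem_range.1 hk; omega
    rw [ofReal_partialFourierSum hint, ← sum_filter, filter_abs_le_Icc_neg hk', trigSum]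
  rw [sum_congr rfl h, sum_comm, mul_sum]
  refine sum_congr rfl fun j _ => ?_
  rw [← sum_filter, sum_const, nsmul_eq_mul]
  have hcard : #{k ∈ range N | |j| ≤ ((k : ℕ) : ℤ)} = N - j.natAbs := by
    have : {k ∈ range N | |j| ≤ ((k : ℕ) : ℤ)} = Ico j.natAbs N := by
      ext k
      simp only [mem_filter, mem_range, mem_Ico, Int.abs_eq_natAbs]
      omega
    rw [this, Nat.card_Ico]
  rw [hcard]
  push_cast
  ring

theorem ofReal_partialFourierSum_sub_fejerMean {f : ℝ → ℝ}
    (hint : IntervalIntegrable f volume 0 (2 * π)) (n : ℕ) : ∃ d : ℤ → ℂ,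
      (∀ x, ((partialFourierSum f n x - fejerMean f (n + 1) x : ℝ) : ℂ) =
        trigSum {k ∈ Icc (-((2 * (n + 1) : ℕ) : ℤ)) (2 * (n + 1) : ℕ) | |k| ≤ n} d x) ∧
      ∀ x, ((2 * (fejerMean f (2 * (n + 1)) x - fejerMean f (n + 1) x) : ℝ) : ℂ) =
        trigSum (Icc (-((2 * (n + 1) : ℕ) : ℤ)) (2 * (n + 1) : ℕ)) d x := by
  refine ⟨fun j => 2 * (1 / (2 * (n + 1) : ℕ) * (2 * (n + 1) - j.natAbs : ℕ) * expCoeff f j -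
    1 / (n + 1 : ℕ) * (n + 1 - j.natAbs : ℕ) * expCoeff f j), fun x => ?_, fun x => ?_⟩
  · rw [filter_abs_le_Icc_neg (by omega), Complex.ofReal_sub, ofReal_partialFourierSum hint,
      ofReal_fejerMean hint (M := n) le_rfl, trigSum, trigSum, trigSum, ← sum_sub_distrib]
    refine sum_congr rfl fun j hj => ?_
    have hj' : j.natAbs ≤ n := by rw [mem_Icc] at hj; omega
    have hn : (n : ℂ) + 1 ≠ 0 := by exact_mod_cast n.succ_ne_zero
    rw [Nat.cast_sub (by omega : j.natAbs ≤ n + 1),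
      Nat.cast_sub (by omega : j.natAbs ≤ 2 * (n + 1))]
    push_cast
    field_simp
    ring
  · rw [Complex.ofReal_mul, Complex.ofReal_sub, ofReal_fejerMean hint (M := 2 * (n + 1)) (by omega),
      ofReal_fejerMean hint (M := 2 * (n + 1)) (by omega), trigSum, trigSum, trigSum,
      ← sum_sub_distrib, mul_sum]
    refine sum_congr rfl fun j _ => ?_
    push_cast
    ring

theorem eLpNorm_eq_of_ofReal_eq {g : ℝ → ℝ} {G : ℝ → ℂ} (h : ∀ x, (g x : ℂ) = G x)
    (q : ENNReal) (μ : Measure ℝ) : eLpNorm g q μ = eLpNorm G q μ :=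
  eLpNorm_congr_norm_ae (Filter.Eventually.of_forall fun x => by rw [← h x, Complex.norm_real])

theorem LipClass.exists_eLpNorm_partialFourierSum_sub_le {α p : ℝ} (hp : 1 < p) (hα0 : 0 < α)
    (hα1 : α < 1) {f : ℝ → ℝ} (hf : LipClass α p f) :
    ∃ C : ℝ, 0 ≤ C ∧ ∀ n : ℕ,
      eLpNorm (fun x => partialFourierSum f n x - f x) (ENNReal.ofReal p) periodMeasure ≤
        ENNReal.ofReal (C * ((n : ℝ) + 1) ^ (-α)) := by
  have hp0 : 0 < p := by linarith
  have hq : 1 ≤ ENNReal.ofReal p := by simpa using hp.le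
  obtain ⟨A, hA⟩ := exists_eLpNorm_trigSum_filter_abs_le hp
  obtain ⟨C, hC0, hC⟩ := hf.exists_eLpNorm_fejerMean_sub_le hp hα0 hα1
  refine ⟨A * (2 * (C + C)) + C, by positivity, fun n => ?_⟩
  set q := ENNReal.ofReal p
  have hfm : AEStronglyMeasurable f periodMeasure := (hf.memLp hp0).1
  have hσm : ∀ N, AEStronglyMeasurable (fejerMean f N) periodMeasure := fun N =>
    (continuous_fejerMean hf.2.1 N).aestronglyMeasurable
  have hSm : AEStronglyMeasurable (partialFourierSum f n) periodMeasure :=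
    (continuous_partialFourierSum hf.2.1 n).aestronglyMeasurable
  set r : ℝ := ((n : ℝ) + 1) ^ (-α)
  have hr : 0 ≤ r := by positivity
  have h1 : eLpNorm (fun x => fejerMean f (n + 1) x - f x) q periodMeasure ≤
      ENNReal.ofReal (C * r) := by
    simpa using hC (n + 1) (by omega)
  have h2 : eLpNorm (fun x => fejerMean f (2 * (n + 1)) x - f x) q periodMeasure ≤
      ENNReal.ofReal (C * r) := by
    refine (hC (2 * (n + 1)) (by omega)).trans (ENNReal.ofReal_le_ofReal ?_)
    refine mul_le_mul_of_nonneg_left (rpow_le_rpow_of_nonpos (by positivity) ?_ (by linarith)) hC0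
    push_cast
    linarith
  have h3 : eLpNorm (fun x => 2 * (fejerMean f (2 * (n + 1)) x - fejerMean f (n + 1) x)) q
      periodMeasure ≤ ENNReal.ofReal (2 * (C + C) * r) := by
    have e : (fun x => 2 * (fejerMean f (2 * (n + 1)) x - fejerMean f (n + 1) x)) =
        (2 : ℝ) • ((fun x => fejerMean f (2 * (n + 1)) x - f x) -
          fun x => fejerMean f (n + 1) x - f x) := by
      funext x
      simp only [Pi.smul_apply, Pi.sub_apply, smul_eq_mul]
      ring
    rw [e, eLpNorm_const_smul, Real.enorm_eq_ofReal zero_le_two, mul_assoc,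
      ENNReal.ofReal_mul zero_le_two, add_mul, ENNReal.ofReal_add (by positivity) (by positivity)]
    exact mul_le_mul_right ((eLpNorm_sub_le ((hσm _).sub hfm) ((hσm _).sub hfm) hq).trans
      (add_le_add h2 h1)) _
  obtain ⟨d, hd1, hd2⟩ := ofReal_partialFourierSum_sub_fejerMean hf.2.1 n
  have h4 : eLpNorm (fun x => partialFourierSum f n x - fejerMean f (n + 1) x) q
      periodMeasure ≤ ENNReal.ofReal (A * (2 * (C + C) * r)) := by
    rw [eLpNorm_eq_of_ofReal_eq hd1, ENNReal.ofReal_mul A.coe_nonneg, ENNReal.ofReal_coe_nnreal]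
    refine (hA _ d n).trans (mul_le_mul_right ?_ _)
    rw [← eLpNorm_eq_of_ofReal_eq hd2]
    exact h3
  have e : (fun x => partialFourierSum f n x - f x) =
      (fun x => partialFourierSum f n x - fejerMean f (n + 1) x) +
        fun x => fejerMean f (n + 1) x - f x := by
    funext x
    simp
  rw [e, add_mul, mul_assoc, ENNReal.ofReal_add (by positivity) (by positivity)]
  exact (eLpNorm_add_le (hSm.sub (hσm _)) ((hσm _).sub hfm) hq).trans (add_le_add h4 h1)

theorem sum_range_rpow_neg_le {α : ℝ} (hα0 : 0 < α) (hα1 : α < 1) (n : ℕ) :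
    ∑ k ∈ range n, ((k : ℝ) + 1) ^ (-α) ≤ 1 / (1 - α) * (n : ℝ) ^ (1 - α) := by
  have hβ : 0 < 1 - α := by linarith
  induction n with
  | zero => simp [zero_rpow hβ.ne']
  | succ n ih =>
    have hn : (0 : ℝ) < (n : ℝ) + 1 := by positivity
    have hs : (-1 : ℝ) ≤ -(1 / ((n : ℝ) + 1)) :=
      neg_le_neg ((div_le_one hn).2 (by linarith [n.cast_nonneg (α := ℝ)]))
    have h := rpow_one_add_le_one_add_mul_self hs hβ.le (by linarith : 1 - α ≤ 1)
    have e1 : 1 + -(1 / ((n : ℝ) + 1)) = n / (n + 1) := by field_simp; ring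
    have e2 : ((n : ℝ) + 1) ^ (1 - α) = (n + 1) * ((n : ℝ) + 1) ^ (-α) := by
      rw [← rpow_one_add' hn.le (by linarith)]; rfl
    rw [e1, div_rpow n.cast_nonneg hn.le, div_le_iff₀ (by positivity), e2] at h
    have h' : (n : ℝ) ^ (1 - α) + (1 - α) * ((n : ℝ) + 1) ^ (-α) ≤
        (n + 1) * ((n : ℝ) + 1) ^ (-α) := by
      refine (add_le_add_left h _).trans (le_of_eq ?_)
      field_simp
      ring
    rw [sum_range_succ, Nat.cast_succ, e2]
    refine (add_le_add_left ih _).trans ?_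
    rw [one_div, ← mul_le_mul_iff_right₀ hβ, mul_add, mul_inv_cancel_left₀ hβ.ne',
      mul_inv_cancel_left₀ hβ.ne']
    exact h'

/-- Abel summation: an antitone sequence weighted by `w` is summed as if `w` were bounded, provided
the averages of `w` are. -/
theorem sum_mul_le_of_sum_le {w r : ℕ → ℝ} {B : ℝ} (hr : Antitone r) (hr0 : ∀ k, 0 ≤ r k)
    (hw : ∀ n : ℕ, ∑ k ∈ range n, w k ≤ B * n) (n : ℕ) :
    ∑ k ∈ range n, w k * r k ≤ B * ∑ k ∈ range n, r k := by
  have key : ∑ k ∈ range n, w k * r k + (B * n - ∑ k ∈ range n, w k) * r n ≤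
      B * ∑ k ∈ range n, r k := by
    induction n with
    | zero => simp
    | succ n ih =>
      have h := mul_le_mul_of_nonneg_left (hr n.le_succ) (sub_nonneg.2 (hw (n + 1)))
      simp only [sum_range_succ, Nat.cast_succ, Nat.succ_eq_add_one] at h ⊢
      linarith
  have := mul_nonneg (sub_nonneg.2 (hw n)) (hr0 n)
  linarith

theorem eLpNorm_rieszMeans_sub_le {p : ℝ} (hp : 1 < p) {f : ℝ → ℝ}
    (hfm : AEStronglyMeasurable f periodMeasure) (hint : IntervalIntegrable f volume 0 (2 * π))
    {w : ℕ → ℝ} (hw : ∀ k, 0 < w k) {e : ℕ → ℝ} (he : ∀ k, 0 ≤ e k)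
    (h : ∀ k, eLpNorm (fun x => partialFourierSum f k x - f x) (ENNReal.ofReal p) periodMeasure ≤
      ENNReal.ofReal (e k)) (n : ℕ) :
    eLpNorm (fun x => rieszMeans w f n x - f x) (ENNReal.ofReal p) periodMeasure ≤
      ENNReal.ofReal (1 / (∑ k ∈ range (n + 1), w k) * ∑ k ∈ range (n + 1), w k * e k) := by
  have hq : 1 ≤ ENNReal.ofReal p := by simpa using hp.le
  have hP : 0 < ∑ k ∈ range (n + 1), w k := sum_pos (fun k _ => hw k) (by simp)
  have e1 : (fun x => rieszMeans w f n x - f x) = (1 / ∑ k ∈ range (n + 1), w k) •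
      ∑ k ∈ range (n + 1), w k • fun x => partialFourierSum f k x - f x := by
    funext x
    simp only [rieszMeans, Pi.smul_apply, Finset.sum_apply, smul_eq_mul, mul_sub, sum_sub_distrib]
    rw [← sum_mul]
    field_simp
  have hm : ∀ k, AEStronglyMeasurable (fun x => partialFourierSum f k x - f x) periodMeasure :=
    fun k => (continuous_partialFourierSum hint k).aestronglyMeasurable.sub hfm
  rw [e1, eLpNorm_const_smul, Real.enorm_eq_ofReal (by positivity),
    ENNReal.ofReal_mul (by positivity),
    ENNReal.ofReal_sum_of_nonneg fun k _ => mul_nonneg (hw k).le (he k)]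
  refine mul_le_mul_right ((eLpNorm_sum_le (fun k _ => (hm k).const_smul (w k)) hq).trans
    (sum_le_sum fun k _ => ?_)) _
  rw [eLpNorm_const_smul, Real.enorm_eq_ofReal (hw k).le, ENNReal.ofReal_mul (hw k).le]
  exact mul_le_mul_right (h k) _

/-- Corollary 1 (ii): if `f ∈ Lip(α,p)`, `p > 1`, `0 < α < 1`, the
weights `(p_k)` are positive, `(p_k) ∈ AMDMS` and `(n+1) = O(P_n)`, then
`‖R_n(f) - f‖_{L^p} = O(n^{-α})`. -/
theorem riesz_approx_AMDMS (p α : ℝ) (hp : 1 < p) (hα0 : 0 < α) (hα1 : α < 1)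
    (f : ℝ → ℝ) (hf : LipClass α p f)
    (w : ℕ → ℝ) (hw : ∀ k, 0 < w k)
    (hAMDMS : ∃ K : ℝ, ∀ m n : ℕ, m ≤ n →
      (1 / ((n : ℝ) + 1)) * ∑ k ∈ Finset.range (n + 1), w k ≤
        K * ((1 / ((m : ℝ) + 1)) * ∑ k ∈ Finset.range (m + 1), w k))
    (hO : ∃ C : ℝ, ∀ n : ℕ, ((n : ℝ) + 1) ≤ C * ∑ k ∈ Finset.range (n + 1), w k) :
    ∃ C : ℝ, ∀ n : ℕ, 1 ≤ n →
      lpNorm p (fun x => rieszMeans w f n x - f x) ≤ C * (n : ℝ) ^ (-α) := by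
  have hp0 : 0 < p := by linarith
  have hβ : 0 < 1 - α := by linarith
  obtain ⟨K, hK⟩ := hAMDMS
  obtain ⟨D, hD⟩ := hO
  obtain ⟨C, hC0, hC⟩ := hf.exists_eLpNorm_partialFourierSum_sub_le hp hα0 hα1
  have hP : ∀ n, 0 < ∑ k ∈ range (n + 1), w k := fun n => sum_pos (fun k _ => hw k) (by simp)
  have hD0 : 0 < D := by
    have h := hD 0
    have h2 := hP 0
    by_contra! hneg
    have := mul_nonpos_of_nonpos_of_nonneg hneg h2.le
    push_cast at h
    linarith
  have hB : ∀ n : ℕ, ∑ k ∈ range n, w k ≤ K * w 0 * n := by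
    rintro (_ | n)
    · simp
    · have h := hK 0 n n.zero_le
      have hn : (0 : ℝ) < (n : ℝ) + 1 := by positivity
      rw [one_div, inv_mul_le_iff₀ hn] at h
      simp only [Nat.cast_zero, zero_add, div_one, one_mul, range_one, sum_singleton] at h
      push_cast
      linarith
  have hB0 : 0 ≤ K * w 0 := by
    have h := hB 1
    simp only [range_one, sum_singleton, Nat.cast_one, mul_one] at h
    exact (hw 0).le.trans h
  have hr : Antitone fun k : ℕ => ((k : ℝ) + 1) ^ (-α) := fun i j hij =>
    rpow_le_rpow_of_nonpos (by positivity) (by gcongr) (by linarith)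
  refine ⟨(1 / (2 * π)) ^ (1 / p) * (C * (K * w 0) * D / (1 - α)), fun n hn => ?_⟩
  have hmem : MemLp (fun x => rieszMeans w f n x - f x) (ENNReal.ofReal p) periodMeasure := by
    refine (memLp_periodMeasure_of_continuous ?_ _).sub (hf.memLp hp0)
    unfold rieszMeans
    exact continuous_const.mul (continuous_finsetSum _ fun k _ =>
      continuous_const.mul (continuous_partialFourierSum hf.2.1 k))
  have hn0 : (0 : ℝ) < n := by exact_mod_cast hn
  have hreal : 1 / (∑ k ∈ range (n + 1), w k) *
      ∑ k ∈ range (n + 1), w k * (C * ((k : ℝ) + 1) ^ (-α)) ≤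
        C * (K * w 0) * D / (1 - α) * (n : ℝ) ^ (-α) := by
    have hsum : ∑ k ∈ range (n + 1), w k * ((k : ℝ) + 1) ^ (-α) ≤
        K * w 0 * (1 / (1 - α) * (((n : ℝ) + 1) * ((n : ℝ) + 1) ^ (-α))) := by
      have h := sum_range_rpow_neg_le hα0 hα1 (n + 1)
      rw [Nat.cast_succ, sub_eq_add_neg, rpow_one_add' (by positivity) (by linarith),
        ← sub_eq_add_neg] at h
      exact (sum_mul_le_of_sum_le hr (fun k => by positivity) hB (n + 1)).trans
        (mul_le_mul_of_nonneg_left h hB0)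
    have hpow : ((n : ℝ) + 1) ^ (-α) ≤ (n : ℝ) ^ (-α) :=
      rpow_le_rpow_of_nonpos hn0 (by linarith) (by linarith)
    rw [one_div, inv_mul_le_iff₀ (hP n)]
    calc ∑ k ∈ range (n + 1), w k * (C * ((k : ℝ) + 1) ^ (-α))
        = C * ∑ k ∈ range (n + 1), w k * ((k : ℝ) + 1) ^ (-α) := by
          rw [mul_sum]
          exact sum_congr rfl fun k _ => mul_left_comm _ _ _
      _ ≤ C * (K * w 0 * (1 / (1 - α) *
            ((D * ∑ k ∈ range (n + 1), w k) * (n : ℝ) ^ (-α)))) := by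
          refine mul_le_mul_of_nonneg_left (hsum.trans ?_) hC0
          have := (hP n).le
          gcongr
          exact hD n
      _ = _ := by ring
  rw [lpNorm_eq_eLpNorm hp0 hmem, mul_assoc]
  refine mul_le_mul_of_nonneg_left (ENNReal.toReal_le_of_le_ofReal (by positivity) ?_)
    (by positivity)
  exact (eLpNorm_rieszMeans_sub_le hp (hf.memLp hp0).1 hf.2.1 hw (fun k => by positivity) hC
    n).trans (ENNReal.ofReal_le_ofReal hreal)
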